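/- Let (R, m) be a commutative Noetherian local ring, a an ideal, and M a finitely generated R-module of dimension n. If p ∈ Att(H_a^n(M)), then cd(a, R/p) = n = dim(R/p), and in the completion setting, for S = R/Ann(M), there exists q ∈ Assh(Ŝ) with p = q ∩ R and dim(Ŝ/(aŜ + q)) = 0. -/

import Mathlib

noncomputable section

universe u

open CategoryTheory

/-- The `i`-th local cohomology of a module with respect to an ideal. -/
abbrev LC {R : Type u} [CommRing R] (J : Ideal R) (i : ℕ) (M : Type u)
    [AddCommGroup M] [Module R M] : ModuleCat.{u} R :=
  (localCohomology J i).obj (ModuleCat.of R M)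

/-- Attached primes of a module: primes of the form `Ann(T/U)`. -/
def Att (R : Type u) [CommRing R] (T : Type u) [AddCommGroup T] [Module R T] :
    Set (Ideal R) :=
  { p | p.IsPrime ∧ ∃ U : Submodule R T, p = Module.annihilator R (T ⧸ U) }

/-- Krull dimension of a module, as the Krull dimension of its support. -/
def mdim (R : Type u) [CommRing R] (M : Type u) [AddCommGroup M] [Module R M] :
    WithBot ℕ∞ :=
  Order.krullDim (Module.support R M)

/-- Cohomological dimension of `M` with respect to `J`:
the supremum of the `i` with `H_J^i(M) ≠ 0` (`⊥` if there are none). -/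
def cohDim (R : Type u) [CommRing R] (J : Ideal R) (M : Type u)
    [AddCommGroup M] [Module R M] : WithBot ℕ∞ :=
  sSup { x | ∃ i : ℕ, x = (i : ℕ∞) ∧ Nontrivial (LC J i M) }


namespace LCproof
open Limits Opposite

variable {R : Type u} [CommRing R]

/-- the unbundled direct limit diagram of a sequence -/
def dlG (F : ℕ ⥤ ModuleCat.{u} R) : ∀ i j : ℕ, i ≤ j → F.obj i →ₗ[R] F.obj j :=
  fun _ _ h => (F.map (homOfLE h)).hom

instance (F : ℕ ⥤ ModuleCat.{u} R) : DirectedSystem (fun i => F.obj i) (fun i j h => dlG F i j h) where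
  map_self i x := by
    show (F.map (𝟙 i)).hom x = x
    rw [F.map_id]; rfl
  map_map i j k hij hjk x := by
    show (F.map _).hom ((F.map _).hom x) = (F.map _).hom x
    rw [← LinearMap.comp_apply, ← ModuleCat.hom_comp, ← F.map_comp]; rfl

/-- direct limit cocone -/
def dlCocone (F : ℕ ⥤ ModuleCat.{u} R) : Cocone F where
  pt := ModuleCat.of R (Module.DirectLimit (fun i => F.obj i) (dlG F))
  ι := { app := fun x => ModuleCat.ofHom (Module.DirectLimit.of R ℕ _ (dlG F) x)
         naturality := fun i j hij => by
          ext x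
          exact Module.DirectLimit.of_f (f := dlG F) (hij := hij.le) (x := x) }

/-- descent -/
def dlDesc (F : ℕ ⥤ ModuleCat.{u} R) (s : Cocone F) :
    Module.DirectLimit (fun i => F.obj i) (dlG F) →ₗ[R] s.pt :=
  Module.DirectLimit.lift R ℕ _ (dlG F) (fun i => (s.ι.app i).hom) fun i j h x => by
      rw [← s.w (homOfLE h)]
      rfl

lemma dlDesc_of (F : ℕ ⥤ ModuleCat.{u} R) (s : Cocone F) (i : ℕ) (x : F.obj i) :
    dlDesc F s (Module.DirectLimit.of R ℕ _ (dlG F) i x) = (s.ι.app i).hom x := by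
  unfold dlDesc
  rw [Module.DirectLimit.lift_of]

/-- it is a colimit -/
def dlIsColimit (F : ℕ ⥤ ModuleCat.{u} R) : IsColimit (dlCocone F) where
  desc s := ModuleCat.ofHom (dlDesc F s)
  fac s i := by
    ext x
    exact dlDesc_of F s i x
  uniq s m h := by
    apply ModuleCat.hom_ext
    apply Module.DirectLimit.hom_ext
    intro i
    ext x
    refine Eq.trans ?_ (dlDesc_of F s i x).symm
    exact congrArg (fun g => ModuleCat.Hom.hom g x) (h i)

/-- comparison -/
def dlIso (F : ℕ ⥤ ModuleCat.{u} R) : colimit F ≅ (dlCocone F).pt :=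
  (colimit.isColimit F).coconePointUniqueUpToIso (dlIsColimit F)

lemma dlIso_ι (F : ℕ ⥤ ModuleCat.{u} R) (t : ℕ) (w : F.obj t) :
    (dlIso F).hom.hom ((colimit.ι F t).hom w) = Module.DirectLimit.of R ℕ _ (dlG F) t w := by
  have := (colimit.isColimit F).comp_coconePointUniqueUpToIso_hom (dlIsColimit F) t
  exact congrArg (fun g => ModuleCat.Hom.hom g w) this

lemma dlIso_inj (F : ℕ ⥤ ModuleCat.{u} R) : Function.Injective (dlIso F).hom.hom :=
  (dlIso F).toLinearEquiv.injective

lemma seq_rep (F : ℕ ⥤ ModuleCat.{u} R) 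
    (z : (colimit F : ModuleCat.{u} R)) : ∃ t, ∃ w : F.obj t, (colimit.ι F t).hom w = z := by
  obtain ⟨t, w, h⟩ := Module.DirectLimit.exists_of (R := R) (G := fun i => F.obj i) (f := dlG F) ((dlIso F).hom.hom z)
  refine ⟨t, w, dlIso_inj F ?_⟩
  rw [dlIso_ι, h]

lemma seq_zero (F : ℕ ⥤ ModuleCat.{u} R) 
    (t : ℕ) (w : F.obj t) (h : (colimit.ι F t).hom w = 0) :
    ∃ s, ∃ f : t ⟶ s, (F.map f).hom w = 0 := by
  have h2 : Module.DirectLimit.of R ℕ _ (dlG F) t w = 0 := by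
    rw [← dlIso_ι, h, map_zero]; rfl
  obtain ⟨s, hs, e⟩ := Module.DirectLimit.of.zero_exact h2
  exact ⟨s, homOfLE hs, e⟩

/-- Hom complex as a functor in the second variable. -/
def HCmap (P : ChainComplex (ModuleCat.{u} R) ℕ) {Y Z : ModuleCat.{u} R} (f : Y ⟶ Z) :
     P.linearYonedaObj R Y ⟶ P.linearYonedaObj R Z where
  f := fun i => ModuleCat.ofHom (Linear.rightComp R (P.X i) f)
  comm' := by
    intro i j _
    apply ModuleCat.hom_ext
    apply LinearMap.ext
    intro g
    exact (Category.assoc (P.d j i) g f).symm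

lemma HCmap_id (P : ChainComplex (ModuleCat.{u} R) ℕ) (Y : ModuleCat.{u} R) :
     HCmap P (𝟙 Y) = 𝟙 _ := by
  ext i : 1
  apply ModuleCat.hom_ext
  apply LinearMap.ext
  intro g
  exact Category.comp_id (X := P.X i) g

lemma HCmap_comp (P : ChainComplex (ModuleCat.{u} R) ℕ) {Y Z W : ModuleCat.{u} R} (f : Y ⟶ Z)
    (g : Z ⟶ W) :
     HCmap P (f ≫ g) = HCmap P f ≫ HCmap P g := by
  ext i : 1
  apply ModuleCat.hom_ext
  apply LinearMap.ext
  intro h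
  exact (Category.assoc (W := P.X i) h f g).symm

lemma HCmap_add (P : ChainComplex (ModuleCat.{u} R) ℕ) {Y Z : ModuleCat.{u} R} (f g : Y ⟶ Z) :
     HCmap P (f + g) = HCmap P f + HCmap P g := by
  ext i : 1
  apply ModuleCat.hom_ext
  apply LinearMap.ext
  intro h
  exact Preadditive.comp_add (P.X i) _ _ h f g

lemma HCmap_zero (P : ChainComplex (ModuleCat.{u} R) ℕ) {Y Z : ModuleCat.{u} R} :
     HCmap P (0 : Y ⟶ Z) = 0 := by
  have h := HCmap_add P (0 : Y ⟶ Z) 0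
  rw [add_zero] at h
  exact left_eq_add.mp h

lemma HCmap_smul (P : ChainComplex (ModuleCat.{u} R) ℕ) {Y Z : ModuleCat.{u} R} (r : R) (f : Y ⟶ Z) :
     HCmap P (r • f) = r • HCmap P f := by
  ext i : 1
  apply ModuleCat.hom_ext
  apply LinearMap.ext
  intro h
  exact Linear.comp_smul (P.X i) _ _ h r f

/-- Hom complex, functoriality in the first variable. -/
def HCm {P Q : ChainComplex (ModuleCat.{u} R) ℕ} (φ : P ⟶ Q) (Y : ModuleCat.{u} R) :
    Q.linearYonedaObj R Y ⟶ P.linearYonedaObj R Y where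
  f := fun i => ModuleCat.ofHom (Linear.leftComp R Y (φ.f i))
  comm' := by
    intro i j _
    apply ModuleCat.hom_ext
    apply LinearMap.ext
    intro g
    have h : ∀ g : Q.X i ⟶ Y, P.d j i ≫ (φ.f i ≫ g) = φ.f j ≫ (Q.d j i ≫ g) := by
      intro g; simp
    exact h g

lemma HCm_nat {P Q : ChainComplex (ModuleCat.{u} R) ℕ} (φ : P ⟶ Q) {Y Z : ModuleCat.{u} R} (f : Y ⟶ Z) :
   HCm φ Y ≫ HCmap P f = HCmap Q f ≫ HCm φ Z := by
  ext i : 1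
  apply ModuleCat.hom_ext
  apply LinearMap.ext
  intro g
  exact Category.assoc (φ.f i) g f

end LCproof


namespace LCproof
open Limits Opposite

variable {R : Type u} [CommRing R]

/-- R / a^t -/
abbrev Rq (a : Ideal R) (t : ℕ) : ModuleCat.{u} R := ModuleCat.of R (R ⧸ a ^ t)

/-- transition -/
def Rqm (a : Ideal R) (t : ℕ) : Rq a (t+1) ⟶ Rq a t :=
  ModuleCat.ofHom <| Submodule.mapQ _ _ LinearMap.id (Ideal.pow_le_pow_right (Nat.le_add_right t 1))

/-- chosen resolutions -/
def PR (a : Ideal R) (t : ℕ) : ProjectiveResolution (Rq a t) := projectiveResolution _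

/-- lifts -/
def PRm (a : Ideal R) (t : ℕ) : (PR a (t+1)).complex ⟶ (PR a t).complex :=
  ProjectiveResolution.lift (Rqm a t) _ _

lemma PRm_comm (a : Ideal R) (t : ℕ) : (PRm a t).f 0 ≫ (PR a t).π.f 0 = (PR a (t+1)).π.f 0 ≫ Rqm a t :=
  ProjectiveResolution.lift_commutes_zero (Rqm a t) (PR a (t+1)) (PR a t)

/-- Hom complexes -/
abbrev HCx (a : Ideal R) (t : ℕ) (Y : ModuleCat.{u} R) : CochainComplex (ModuleCat.{u} R) ℕ :=
  (PR a t).complex.linearYonedaObj R Y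

/-- the system -/
def Hs (a : Ideal R) (i : ℕ) (Y : ModuleCat.{u} R) : ℕ ⥤ ModuleCat.{u} R :=
  Functor.ofSequence (X := fun t => (HCx a t Y).homology i)
    (fun t => HomologicalComplex.homologyMap (HCm (PRm a t) Y) i)

lemma Hs_step (a : Ideal R) (i : ℕ) (Y : ModuleCat.{u} R) (t : ℕ) :
   (Hs a i Y).map (homOfLE (Nat.le_add_right t 1)) = HomologicalComplex.homologyMap (HCm (PRm a t) Y) i :=
  Functor.ofSequence_map_homOfLE_succ _ _

/-- maps of systems -/
def Hsm (a : Ideal R) (i : ℕ) {Y Z : ModuleCat.{u} R} (f : Y ⟶ Z) : Hs a i Y ⟶ Hs a i Z :=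
  NatTrans.ofSequence (fun t => HomologicalComplex.homologyMap (HCmap (PR a t).complex f) i) (by
    intro t
    rw [Hs_step, Hs_step]
    refine (HomologicalComplex.homologyMap_comp _ _ i).symm.trans ?_
    refine Eq.trans ?_ (HomologicalComplex.homologyMap_comp _ _ i)
    rw [HCm_nat])

/-- local cohomology model -/
def HH (a : Ideal R) (i : ℕ) (Y : ModuleCat.{u} R) : ModuleCat.{u} R := colimit (Hs a i Y)

/-- structure maps -/
def ιH (a : Ideal R) (i : ℕ) (Y : ModuleCat.{u} R) (t : ℕ) : (HCx a t Y).homology i ⟶ HH a i Y :=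
  colimit.ι (Hs a i Y) t

lemma HH_hom_ext {a : Ideal R} {i : ℕ} {Y Z : ModuleCat.{u} R} {f g : HH a i Y ⟶ Z}
    (h : ∀ t, ιH a i Y t ≫ f = ιH a i Y t ≫ g) : f = g := colimit.hom_ext h

lemma ιH_step (a : Ideal R) (i : ℕ) (Y : ModuleCat.{u} R) (t : ℕ) :
    HomologicalComplex.homologyMap (HCm (PRm a t) Y) i ≫ ιH a i Y (t+1) = ιH a i Y t := by
  have := colimit.w (Hs a i Y) (homOfLE (Nat.le_add_right t 1))
  rw [Hs_step] at this
  exact this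

lemma HH_rep {a : Ideal R} {i : ℕ} {Y : ModuleCat.{u} R} (z : HH a i Y) :
    ∃ t, ∃ w : (HCx a t Y).homology i, (ιH a i Y t).hom w = z := seq_rep _ z

/-- transition maps -/
def Htr (a : Ideal R) (i : ℕ) (Y : ModuleCat.{u} R) {t s : ℕ} (f : t ⟶ s) :
    (HCx a t Y).homology i ⟶ (HCx a s Y).homology i := (Hs a i Y).map f

lemma Htr_ι (a : Ideal R) (i : ℕ) (Y : ModuleCat.{u} R) {t s : ℕ} (f : t ⟶ s) :
    Htr a i Y f ≫ ιH a i Y s = ιH a i Y t := colimit.w (Hs a i Y) f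

lemma HH_zero {a : Ideal R} {i : ℕ} {Y : ModuleCat.{u} R} {t : ℕ} (w : (HCx a t Y).homology i)
    (h : (ιH a i Y t).hom w = 0) : ∃ s, ∃ f : t ⟶ s, (Htr a i Y f).hom w = 0 :=
  seq_zero (Hs a i Y) t w h

/-- descent from step compatibility -/
def HHdesc (a : Ideal R) (i : ℕ) (Y Z : ModuleCat.{u} R) (g : ∀ t, (HCx a t Y).homology i ⟶ Z)
    (hg : ∀ t, HomologicalComplex.homologyMap (HCm (PRm a t) Y) i ≫ g (t+1) = g t) : HH a i Y ⟶ Z :=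
  colimit.desc (Hs a i Y) { pt := Z, ι := NatTrans.ofSequence g (by
    intro t
    rw [Hs_step]
    exact (hg t).trans (Category.comp_id _).symm) }

lemma ι_HHdesc (a : Ideal R) (i : ℕ) (Y Z : ModuleCat.{u} R) (g : ∀ t, (HCx a t Y).homology i ⟶ Z)
    (hg : ∀ t, HomologicalComplex.homologyMap (HCm (PRm a t) Y) i ≫ g (t+1) = g t) (t : ℕ) :
    ιH a i Y t ≫ HHdesc a i Y Z g hg = g t := colimit.ι_desc _ t

/-- the map -/
def HHm (a : Ideal R) (i : ℕ) {Y Z : ModuleCat.{u} R} (f : Y ⟶ Z) : HH a i Y ⟶ HH a i Z :=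
  colimMap (Hsm a i f)

/-- Map on homology of Hom complexes. -/
abbrev Htm (a : Ideal R) (i t : ℕ) {Y Z : ModuleCat.{u} R} (f : Y ⟶ Z) :
    (HCx a t Y).homology i ⟶ (HCx a t Z).homology i :=
  HomologicalComplex.homologyMap (HCmap (PR a t).complex f) i

lemma ι_HHm (a : Ideal R) (i : ℕ) {Y Z : ModuleCat.{u} R} (f : Y ⟶ Z) (t : ℕ) :
   ιH a i Y t ≫ HHm a i f = Htm a i t f ≫ ιH a i Z t := ι_colimMap _ _

lemma Htr_Htm (a : Ideal R) (i : ℕ) {Y Z : ModuleCat.{u} R} (f : Y ⟶ Z) {t s : ℕ} (h : t ⟶ s) :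
   Htr a i Y h ≫ Htm a i s f = Htm a i t f ≫ Htr a i Z h := (Hsm a i f).naturality h

lemma HHm_id (a : Ideal R) (i : ℕ) (Y : ModuleCat.{u} R) : HHm a i (𝟙 Y) = 𝟙 _ := by
  apply HH_hom_ext
  intro t
  rw [ι_HHm, Htm, HCmap_id, HomologicalComplex.homologyMap_id]
  exact (Category.id_comp _).trans (Category.comp_id _).symm

lemma HHm_comp (a : Ideal R) (i : ℕ) {Y Z W : ModuleCat.{u} R} (f : Y ⟶ Z) (g : Z ⟶ W) :
    HHm a i (f ≫ g) = HHm a i f ≫ HHm a i g := by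
  apply HH_hom_ext
  intro t
  rw [← Category.assoc, ι_HHm, ι_HHm, Htm, HCmap_comp, HomologicalComplex.homologyMap_comp, Category.assoc, Category.assoc, ι_HHm]

lemma HHm_add (a : Ideal R) (i : ℕ) {Y Z : ModuleCat.{u} R} (f g : Y ⟶ Z) :
    HHm a i (f + g) = HHm a i f + HHm a i g := by
  apply HH_hom_ext
  intro t
  rw [ι_HHm, Htm, HCmap_add, HomologicalComplex.homologyMap_add, Preadditive.comp_add, ι_HHm, ι_HHm,
    Preadditive.add_comp]

lemma homologyMap_smul' {K L : CochainComplex (ModuleCat.{u} R) ℕ} (f : K ⟶ L) (r : R) (i : ℕ) :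
    HomologicalComplex.homologyMap (r • f) i = r • HomologicalComplex.homologyMap f i :=
  ShortComplex.homologyMap_smul (S₁ := K.sc i) (S₂ := L.sc i)
    ((HomologicalComplex.shortComplexFunctor (ModuleCat.{u} R) (ComplexShape.up ℕ) i).map f) r

lemma HHm_smul (a : Ideal R) (i : ℕ) {Y Z : ModuleCat.{u} R} (r : R) (f : Y ⟶ Z) :
    HHm a i (r • f) = r • HHm a i f := by
  apply HH_hom_ext
  intro t
  rw [ι_HHm, Htm, HCmap_smul, homologyMap_smul', Linear.comp_smul, ι_HHm,
    Linear.smul_comp]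

end LCproof


namespace LCproof
open Limits Opposite

variable {R : Type u} [CommRing R]

lemma iso_square {C : Type*} [Category C] {X Y X' Y' : C} (e : X ≅ X') (e' : Y ≅ Y') (f : X ⟶ Y)
    (g : X' ⟶ Y') (h : f ≫ e'.hom = e.hom ≫ g) : e.inv ≫ f = g ≫ e'.inv := by
  rw [Iso.inv_comp_eq, ← Category.assoc, Iso.eq_comp_inv]
  exact h

lemma isoExt_nat {X Y : ModuleCat.{u} R} (f : X ⟶ Y) (P : ProjectiveResolution X)
    (Q : ProjectiveResolution Y) (φ : P.complex ⟶ Q.complex) (comm : φ.f 0 ≫ Q.π.f 0 = P.π.f 0 ≫ f)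
    (n : ℕ) (Z : ModuleCat.{u} R) :
    ((Ext R (ModuleCat.{u} R) n).map f.op).app Z ≫ (P.isoExt n Z : _ ≅ (P.complex.linearYonedaObj R Z).homology n).hom =
      (Q.isoExt n Z : _ ≅ (Q.complex.linearYonedaObj R Z).homology n).hom ≫ 
        HomologicalComplex.homologyMap (HCm φ Z) n := by
  have h1 := ProjectiveResolution.isoLeftDerivedObj_inv_naturality f P Q φ comm ((linearYoneda R (ModuleCat.{u} R)).obj Z).rightOp n
  have h2 := congrArg Quiver.Hom.unop h1
  have h3 := HomologicalComplex.homologyOp_hom_naturality (HCm φ Z) n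
  have h4 : (HomologicalComplex.homologyOp (P.complex.linearYonedaObj R Z) n).inv ≫
      HomologicalComplex.homologyMap ((HomologicalComplex.opFunctor _ _).map (HCm φ Z).op) n = 
      (HomologicalComplex.homologyMap (HCm φ Z) n).op ≫ (HomologicalComplex.homologyOp (Q.complex.linearYonedaObj R Z) n).inv := by
    exact iso_square _ _ _ _ h3
  have h5 := congrArg Quiver.Hom.unop h4
  refine (Category.assoc _ _ _).symm.trans ?_
  refine (congrArg (fun g => g ≫ (HomologicalComplex.homologyOp (P.complex.linearYonedaObj R Z) n).inv.unop) h2).trans ?_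
  refine (Category.assoc _ _ _).trans ?_
  refine Eq.trans ?_ (Category.assoc _ _ _).symm
  exact congrArg (fun g => (Q.isoLeftDerivedObj ((linearYoneda R (ModuleCat.{u} R)).obj Z).rightOp n).inv.unop ≫ g) h5

/-- iso -/
def LCiso (a : Ideal R) (i : ℕ) (M : ModuleCat.{u} R) : (localCohomology a i).obj M ≅ HH a i M := by
  haveI : HasColimit (localCohomology.diagram (localCohomology.idealPowersDiagram a) i) :=
    localCohomology.hasColimitDiagram _ _
  refine (colimitObjIsoColimitCompEvaluation (localCohomology.diagram (localCohomology.idealPowersDiagram a) i) M) ≪≫ ?_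
  refine (Functor.Final.colimitIso (opOp ℕ) _).symm ≪≫ ?_
  let η : opOp ℕ ⋙ localCohomology.diagram (localCohomology.idealPowersDiagram a) i ⋙ (evaluation _ _).obj M ⟶ Hs a i M :=
    NatTrans.ofSequence (fun t => ((PR a t).isoExt i M : _ ≅ (HCx a t M).homology i).hom) (by
      intro t
      rw [Hs_step]
      exact isoExt_nat _ _ _ _ (PRm_comm a t) i M)
  have : ∀ t, IsIso (η.app t) := fun t => by
    show IsIso ((PR a t).isoExt i M : _ ≅ (HCx a t M).homology i).hom
    infer_instance
  haveI : IsIso η := NatIso.isIso_of_isIso_app η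
  exact HasColimit.isoOfNatIso (asIso η)

end LCproof


namespace LCproof
open Limits Opposite

variable {R : Type u} [CommRing R]

/-- short complex of Hom complexes -/
def SCx (P : ChainComplex (ModuleCat.{u} R) ℕ) (S : ShortComplex (ModuleCat.{u} R)) :
    ShortComplex (CochainComplex (ModuleCat.{u} R) ℕ) :=
  ShortComplex.mk (HCmap P S.f) (HCmap P S.g) (by rw [← HCmap_comp, S.zero, HCmap_zero])

lemma SCx_exact (P : ChainComplex (ModuleCat.{u} R) ℕ) [∀ i, Projective (P.X i)]
    {S : ShortComplex (ModuleCat.{u} R)} (hS : S.ShortExact) : (SCx P S).ShortExact := by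
  apply HomologicalComplex.shortExact_of_degreewise_shortExact
  intro i
  have := hS.mono_f
  have := hS.epi_g
  have h1 : Function.Injective (Linear.rightComp R (P.X i) S.f) := by
    intro x y h
    exact (cancel_mono S.f).1 h
  have h2 : Function.Surjective (Linear.rightComp R (P.X i) S.g) := by
    intro x
    exact ⟨Projective.factorThru x S.g, Projective.factorThru_comp x S.g⟩
  have h3 : ∀ x : P.X i ⟶ S.X₂, x ≫ S.g = 0 → ∃ y : P.X i ⟶ S.X₁, y ≫ S.f = x := by
    intro x hx
    exact ⟨hS.exact.lift x hx, hS.exact.lift_f x hx⟩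
  refine ShortComplex.ShortExact.mk' ?_ ?_ ?_
  · rw [ShortComplex.moduleCat_exact_iff]
    intro x hx
    exact h3 x hx
  · rw [ModuleCat.mono_iff_injective]
    exact h1
  · rw [ModuleCat.epi_iff_surjective]
    exact h2

instance (a : Ideal R) (t i : ℕ) : Projective ((PR a t).complex.X i) := (PR a t).projective i

/-- morphism of short complexes -/
def SCxm {P Q : ChainComplex (ModuleCat.{u} R) ℕ} (φ : P ⟶ Q) (S : ShortComplex (ModuleCat.{u} R)) :
    SCx Q S ⟶ SCx P S where
  τ₁ := HCm φ _
  τ₂ := HCm φ _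
  τ₃ := HCm φ _
  comm₁₂ := HCm_nat φ S.f
  comm₂₃ := HCm_nat φ S.g

/-- stage connecting map -/
def δt (a : Ideal R) {S : ShortComplex (ModuleCat.{u} R)} (hS : S.ShortExact) (i t : ℕ) :
    (HCx a t S.X₃).homology i ⟶ (HCx a t S.X₁).homology (i+1) :=
  (SCx_exact (PR a t).complex hS).δ i (i+1) rfl

lemma δt_nat (a : Ideal R) {S : ShortComplex (ModuleCat.{u} R)} (hS : S.ShortExact) (i t : ℕ) :
    HomologicalComplex.homologyMap (HCm (PRm a t) S.X₃) i ≫ δt a hS i (t+1) = 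
    δt a hS i t ≫ HomologicalComplex.homologyMap (HCm (PRm a t) S.X₁) (i+1) :=
  (HomologicalComplex.HomologySequence.δ_naturality (SCxm (PRm a t) S) (SCx_exact (PR a t).complex hS)
    (SCx_exact (PR a (t+1)).complex hS) i (i+1) rfl).symm

/-- connecting map -/
def HHδ (a : Ideal R) {S : ShortComplex (ModuleCat.{u} R)} (hS : S.ShortExact) (i : ℕ) :
    HH a i S.X₃ ⟶ HH a (i+1) S.X₁ :=
  HHdesc a i S.X₃ _ (fun t => δt a hS i t ≫ ιH a (i+1) S.X₁ t) (by
    intro t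
    rw [← Category.assoc, δt_nat, Category.assoc, ιH_step])

lemma ι_HHδ (a : Ideal R) {S : ShortComplex (ModuleCat.{u} R)} (hS : S.ShortExact) (i t : ℕ) :
    ιH a i S.X₃ t ≫ HHδ a hS i = δt a hS i t ≫ ιH a (i+1) S.X₁ t := ι_HHdesc _ _ _ _ _ _ _

/-- transition compatibility -/
lemma Htr_δt (a : Ideal R) {S : ShortComplex (ModuleCat.{u} R)} (hS : S.ShortExact) (i : ℕ) {t s : ℕ}
    (f : t ⟶ s) : Htr a i S.X₃ f ≫ δt a hS i s = δt a hS i t ≫ Htr a (i+1) S.X₁ f := by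
  let η : Hs a i S.X₃ ⟶ Hs a (i+1) S.X₁ := NatTrans.ofSequence (fun t => δt a hS i t) (by
    intro t
    rw [Hs_step, Hs_step]
    exact δt_nat a hS i t)
  exact η.naturality f

lemma capp {X Y Z W : ModuleCat.{u} R} {f : X ⟶ Y} {g : Y ⟶ Z} {f' : X ⟶ W} {g' : W ⟶ Z}
  (h : f ≫ g = f' ≫ g') (x : X) : g.hom (f.hom x) = g'.hom (f'.hom x) := 
  congrArg (fun k => ModuleCat.Hom.hom k x) h

lemma capp1 {X Y Z : ModuleCat.{u} R} {f : X ⟶ Y} {g : Y ⟶ Z} {f' : X ⟶ Z}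
  (h : f ≫ g = f') (x : X) : g.hom (f.hom x) = f'.hom x := 
  congrArg (fun k => ModuleCat.Hom.hom k x) h

lemma ex2t (a : Ideal R) {S : ShortComplex (ModuleCat.{u} R)} (hS : S.ShortExact) (i t : ℕ)
    (z : (HCx a t S.X₂).homology i) (hz : (Htm a i t S.g).hom z = 0) : ∃ y, (Htm a i t S.f).hom y = z :=
  (ShortComplex.moduleCat_exact_iff _).1 ((SCx_exact (PR a t).complex hS).homology_exact₂ i) z hz

lemma ex3t (a : Ideal R) {S : ShortComplex (ModuleCat.{u} R)} (hS : S.ShortExact) (i t : ℕ)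
    (z : (HCx a t S.X₃).homology i) (hz : (δt a hS i t).hom z = 0) : ∃ y, (Htm a i t S.g).hom y = z :=
  (ShortComplex.moduleCat_exact_iff _).1 ((SCx_exact (PR a t).complex hS).homology_exact₃ i (i+1) rfl) z hz

lemma ex1t (a : Ideal R) {S : ShortComplex (ModuleCat.{u} R)} (hS : S.ShortExact) (i t : ℕ)
    (z : (HCx a t S.X₁).homology (i+1)) (hz : (Htm a (i+1) t S.f).hom z = 0) : ∃ y, (δt a hS i t).hom y = z :=
  (ShortComplex.moduleCat_exact_iff _).1 ((SCx_exact (PR a t).complex hS).homology_exact₁ i (i+1) rfl) z hz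

lemma comp31 (a : Ideal R) {S : ShortComplex (ModuleCat.{u} R)} (hS : S.ShortExact) (i t : ℕ) :
   Htm a i t S.g ≫ δt a hS i t = 0 := (SCx_exact (PR a t).complex hS).comp_δ i (i+1) rfl

lemma comp12 (a : Ideal R) {S : ShortComplex (ModuleCat.{u} R)} (hS : S.ShortExact) (i t : ℕ) :
   δt a hS i t ≫ Htm a (i+1) t S.f = 0 := (SCx_exact (PR a t).complex hS).δ_comp i (i+1) rfl

lemma ex2 (a : Ideal R) {S : ShortComplex (ModuleCat.{u} R)} (hS : S.ShortExact) (i : ℕ)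
    (z : HH a i S.X₂) (hz : (HHm a i S.g).hom z = 0) : ∃ y, (HHm a i S.f).hom y = z := by
  obtain ⟨t, w, rfl⟩ := HH_rep z
  rw [capp (ι_HHm a i S.g t)] at hz
  obtain ⟨s, f, h⟩ := HH_zero _ hz
  rw [← capp (Htr_Htm a i S.g f)] at h
  obtain ⟨y, hy⟩ := ex2t a hS i s _ h
  refine ⟨(ιH a i _ s).hom y, ?_⟩
  rw [capp (ι_HHm a i S.f s), hy, capp1 (Htr_ι a i _ f)]

lemma ex3 (a : Ideal R) {S : ShortComplex (ModuleCat.{u} R)} (hS : S.ShortExact) (i : ℕ)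
    (z : HH a i S.X₃) (hz : (HHδ a hS i).hom z = 0) : ∃ y, (HHm a i S.g).hom y = z := by
  obtain ⟨t, w, rfl⟩ := HH_rep z
  rw [capp (ι_HHδ a hS i t)] at hz
  obtain ⟨s, f, h⟩ := HH_zero _ hz
  rw [← capp (Htr_δt a hS i f)] at h
  obtain ⟨y, hy⟩ := ex3t a hS i s _ h
  refine ⟨(ιH a i _ s).hom y, ?_⟩
  rw [capp (ι_HHm a i S.g s), hy, capp1 (Htr_ι a i _ f)]

lemma ex1 (a : Ideal R) {S : ShortComplex (ModuleCat.{u} R)} (hS : S.ShortExact) (i : ℕ)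
    (z : HH a (i+1) S.X₁) (hz : (HHm a (i+1) S.f).hom z = 0) : ∃ y, (HHδ a hS i).hom y = z := by
  obtain ⟨t, w, rfl⟩ := HH_rep z
  rw [capp (ι_HHm a (i+1) S.f t)] at hz
  obtain ⟨s, f, h⟩ := HH_zero _ hz
  rw [← capp (Htr_Htm a (i+1) S.f f)] at h
  obtain ⟨y, hy⟩ := ex1t a hS i s _ h
  refine ⟨(ιH a i _ s).hom y, ?_⟩
  rw [capp (ι_HHδ a hS i s), hy, capp1 (Htr_ι a (i+1) _ f)]

lemma ex31 (a : Ideal R) {S : ShortComplex (ModuleCat.{u} R)} (hS : S.ShortExact) (i : ℕ)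
    (z : HH a i S.X₂) : (HHδ a hS i).hom ((HHm a i S.g).hom z) = 0 := by
  obtain ⟨t, w, rfl⟩ := HH_rep z
  rw [capp (ι_HHm a i S.g t), capp (ι_HHδ a hS i t), capp1 (comp31 a hS i t)]
  exact map_zero _

lemma ex12 (a : Ideal R) {S : ShortComplex (ModuleCat.{u} R)} (hS : S.ShortExact) (i : ℕ)
    (z : HH a i S.X₃) : (HHm a (i+1) S.f).hom ((HHδ a hS i).hom z) = 0 := by
  obtain ⟨t, w, rfl⟩ := HH_rep z
  rw [capp (ι_HHδ a hS i t), capp (ι_HHm a (i+1) S.f t), capp1 (comp12 a hS i t)]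
  exact map_zero _

end LCproof


namespace LCproof
open Limits Opposite

variable {R : Type u} [CommRing R]

/-- augmentation -/
def πa (a : Ideal R) (t : ℕ) : (PR a t).complex.X 0 ⟶ Rq a t := (PR a t).π.f 0

lemma πa_surj (a : Ideal R) (t : ℕ) : Function.Surjective (πa a t).hom := by
  have : Epi (πa a t) := inferInstanceAs (Epi ((PR a t).π.f 0))
  exact (ModuleCat.epi_iff_surjective _).1 this

/-- lift of one -/
def et (a : Ideal R) (t : ℕ) : (PR a t).complex.X 0 := (πa_surj a t (1 : R ⧸ a ^ t)).choose

lemma et_spec (a : Ideal R) (t : ℕ) : (πa a t).hom (et a t) = (1 : R ⧸ a ^ t) :=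
  (πa_surj a t (1 : R ⧸ a ^ t)).choose_spec

lemma d_πa (a : Ideal R) (t : ℕ) : (PR a t).complex.d 1 0 ≫ πa a t = 0 :=
  (PR a t).complex_d_comp_π_f_zero

lemma cyc_fac (a : Ideal R) (t : ℕ) {Y : ModuleCat.{u} R} (g : (PR a t).complex.X 0 ⟶ Y)
    (hg : (PR a t).complex.d 1 0 ≫ g = 0) : ∃ h : Rq a t ⟶ Y, πa a t ≫ h = g :=
  ⟨CokernelCofork.IsColimit.desc' (PR a t).isColimitCokernelCofork g hg |>.1,
   (CokernelCofork.IsColimit.desc' (PR a t).isColimitCokernelCofork g hg).2⟩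

/-- evaluation -/
def evt (a : Ideal R) (t : ℕ) (Y : ModuleCat.{u} R) : (HCx a t Y).X 0 ⟶ Y :=
  ModuleCat.ofHom (Y := Y) (show ((PR a t).complex.X 0 ⟶ Y) →ₗ[R] Y from
  { toFun := fun g => g.hom (et a t)
    map_add' := fun _ _ => rfl
    map_smul' := fun _ _ => rfl })

/-- cocycle of class -/
def cy (a : Ideal R) (t : ℕ) (Y : ModuleCat.{u} R) : (HCx a t Y).homology 0 ⟶ (HCx a t Y).X 0 :=
  (HCx a t Y).isoHomologyπ₀.inv ≫ (HCx a t Y).iCycles 0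

lemma cy_d (a : Ideal R) (t : ℕ) (Y : ModuleCat.{u} R) : cy a t Y ≫ (HCx a t Y).d 0 1 = 0 := by
  unfold cy
  rw [Category.assoc, HomologicalComplex.iCycles_d, comp_zero]

lemma cy_inj (a : Ideal R) (t : ℕ) (Y : ModuleCat.{u} R) : Function.Injective (cy a t Y).hom := by
  have : Mono (cy a t Y) := by unfold cy; infer_instance
  exact (ModuleCat.mono_iff_injective _).1 this

lemma cy_surj (a : Ideal R) (t : ℕ) (Y : ModuleCat.{u} R) (g : (HCx a t Y).X 0)
    (hg : ((HCx a t Y).d 0 1).hom g = 0) : ∃ w, (cy a t Y).hom w = g := by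
  let f : ModuleCat.of R (ULift.{u} R) ⟶ (HCx a t Y).X 0 :=
    ModuleCat.ofHom ((LinearMap.toSpanSingleton R _ g).comp ULift.moduleEquiv.toLinearMap)
  have hf : f ≫ (HCx a t Y).d 0 1 = 0 := by
    apply ModuleCat.hom_ext
    apply LinearMap.ext
    intro x
    show ((HCx a t Y).d 0 1).hom (x.down • g) = 0
    rw [map_smul, hg, smul_zero]
  let k := (HCx a t Y).liftCycles f 1 (by simp) hf
  refine ⟨((HCx a t Y).isoHomologyπ₀.hom).hom (k.hom ⟨1⟩), ?_⟩
  have h1 : k ≫ (HCx a t Y).isoHomologyπ₀.hom ≫ cy a t Y = f := by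
    unfold cy
    rw [Iso.hom_inv_id_assoc]
    exact HomologicalComplex.liftCycles_i _ _ _ _ _
  have := congrArg (fun k => ModuleCat.Hom.hom k (ULift.up.{u} (1 : R))) h1
  exact this.trans (one_smul R g)

lemma cy_fac (a : Ideal R) (t : ℕ) (Y : ModuleCat.{u} R) (w : (HCx a t Y).homology 0) :
    ∃ h : Rq a t ⟶ Y, (πa a t ≫ h : (PR a t).complex.X 0 ⟶ Y) = (cy a t Y).hom w := by
  apply cyc_fac
  exact congrArg (fun k => ModuleCat.Hom.hom k w) (cy_d a t Y)

/-- stage version of epsilon -/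
def εt (a : Ideal R) (t : ℕ) (Y : ModuleCat.{u} R) : (HCx a t Y).homology 0 ⟶ Y :=
  cy a t Y ≫ evt a t Y

lemma εt_fac (a : Ideal R) (t : ℕ) (Y : ModuleCat.{u} R) (w : (HCx a t Y).homology 0) 
    (h : Rq a t ⟶ Y) (hh : (πa a t ≫ h : (PR a t).complex.X 0 ⟶ Y) = (cy a t Y).hom w) :
    (εt a t Y).hom w = h.hom (1 : R ⧸ a ^ t) := by
  show (show (PR a t).complex.X 0 ⟶ Y from (cy a t Y).hom w).hom (et a t) = _
  rw [← hh, ← et_spec]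
  rfl

lemma εt_step (a : Ideal R) (t : ℕ) (Y : ModuleCat.{u} R) :
    HomologicalComplex.homologyMap (HCm (PRm a t) Y) 0 ≫ εt a (t+1) Y = εt a t Y := by
  apply ModuleCat.hom_ext
  apply LinearMap.ext
  intro w
  obtain ⟨h, hh⟩ := cy_fac a t Y w
  rw [εt_fac a t Y w h hh]
  refine Eq.trans (εt_fac a (t+1) Y ((HomologicalComplex.homologyMap (HCm (PRm a t) Y) 0).hom w) (Rqm a t ≫ h) ?_) ?_
  · have h2 : HomologicalComplex.homologyMap (HCm (PRm a t) Y) 0 ≫ cy a (t+1) Y = cy a t Y ≫ (HCm (PRm a t) Y).f 0 := by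
      unfold cy
      rw [CochainComplex.isoHomologyπ₀_inv_naturality_assoc, HomologicalComplex.cyclesMap_i, Category.assoc]
    rw [capp h2]
    have h3 : (πa a (t+1) ≫ Rqm a t ≫ h) = (PRm a t).f 0 ≫ πa a t ≫ h := by
      rw [← Category.assoc, ← Category.assoc]
      congr 1
      exact (PRm_comm a t).symm
    rw [h3, hh]
    rfl
  · rfl

/-- epsilon -/
def εH (a : Ideal R) (Y : ModuleCat.{u} R) : HH a 0 Y ⟶ Y := HHdesc a 0 Y Y (εt a · Y) (εt_step a · Y)

lemma ι_εH (a : Ideal R) (Y : ModuleCat.{u} R) (t : ℕ) : ιH a 0 Y t ≫ εH a Y = εt a t Y := ι_HHdesc _ _ _ _ _ _ _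

lemma εH_inj (a : Ideal R) (Y : ModuleCat.{u} R) : Function.Injective (εH a Y).hom := by
  rw [injective_iff_map_eq_zero]
  intro z hz
  obtain ⟨t, w, rfl⟩ := HH_rep z
  rw [capp1 (ι_εH a Y t)] at hz
  obtain ⟨h, hh⟩ := cy_fac a t Y w
  rw [εt_fac a t Y w h hh] at hz
  have h0 : h = 0 := by
    apply ModuleCat.hom_ext
    apply LinearMap.ext
    intro x
    obtain ⟨r, rfl⟩ := Ideal.Quotient.mk_surjective x
    have : (Ideal.Quotient.mk (a^t) r) = r • (1 : R ⧸ a^t) := by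
      rw [Algebra.smul_def, mul_one]; rfl
    rw [this, map_smul, hz, smul_zero]; rfl
  subst h0
  have : w = 0 := by
    apply cy_inj a t Y
    rw [← hh, map_zero, comp_zero]
    rfl
  rw [this, map_zero]

lemma εH_tors (a : Ideal R) (Y : ModuleCat.{u} R) (z : HH a 0 Y) : ∃ t, ∀ r ∈ a ^ t, r • (εH a Y).hom z = 0 := by
  obtain ⟨t, w, rfl⟩ := HH_rep z
  refine ⟨t, fun r hr => ?_⟩
  rw [capp1 (ι_εH a Y t)]
  obtain ⟨h, hh⟩ := cy_fac a t Y w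
  rw [εt_fac a t Y w h hh, ← map_smul]
  have : r • (1 : R ⧸ a^t) = 0 := by
    rw [Algebra.smul_def, mul_one]; exact Ideal.Quotient.eq_zero_iff_mem.2 hr
  rw [this, map_zero]

lemma εH_surj (a : Ideal R) (Y : ModuleCat.{u} R) (y : Y) (t : ℕ) (hy : ∀ r ∈ a ^ t, r • y = 0) :
    ∃ z, (εH a Y).hom z = y := by
  let h : Rq a t ⟶ Y := ModuleCat.ofHom (Submodule.liftQ _ (LinearMap.toSpanSingleton R _ y) (fun r hr => hy r hr))
  obtain ⟨w, hw⟩ := cy_surj a t Y (πa a t ≫ h : (PR a t).complex.X 0 ⟶ Y) (by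
    show (PR a t).complex.d 1 0 ≫ πa a t ≫ h = 0
    rw [← Category.assoc, d_πa, zero_comp])
  refine ⟨(ιH a 0 Y t).hom w, ?_⟩
  rw [capp1 (ι_εH a Y t), εt_fac a t Y w h hw.symm]
  exact one_smul R y

lemma εH_nat (a : Ideal R) {Y Z : ModuleCat.{u} R} (f : Y ⟶ Z) : HHm a 0 f ≫ εH a Z = εH a Y ≫ f := by
  apply HH_hom_ext
  intro t
  rw [← Category.assoc, ι_HHm, ← Category.assoc, ι_εH, Category.assoc, ι_εH]
  unfold εt cy
  rw [Category.assoc, Category.assoc, CochainComplex.isoHomologyπ₀_inv_naturality_assoc,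
    HomologicalComplex.cyclesMap_i_assoc]
  rfl

lemma HH_injective (a : Ideal R) (i : ℕ) (J : ModuleCat.{u} R) [Injective J] (z : HH a (i+1) J) : z = 0 := by
  obtain ⟨t, w, rfl⟩ := HH_rep z
  have h0 : IsZero ((HCx a t J).homology (i+1)) := by
    rw [← HomologicalComplex.exactAt_iff_isZero_homology, HomologicalComplex.exactAt_iff' _ i (i+1) (i+2) (by simp) (by simp)]
    rw [ShortComplex.moduleCat_exact_iff]
    intro g hg
    exact ⟨((PR a t).exact_succ i).descToInjective (J := J) g hg, ((PR a t).exact_succ i).comp_descToInjective (J := J) g hg⟩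
  have h1 : w = 0 := by
    have := h0.eq_of_src (𝟙 _) 0
    exact congrArg (fun k => ModuleCat.Hom.hom k w) this
  rw [h1, map_zero]

end LCproof


namespace LCproof
open Limits Opposite

variable {R : Type u} [CommRing R]

/-- module-level local cohomology -/
def H (a : Ideal R) (i : ℕ) (N : Type u) [AddCommGroup N] [Module R N] : Type u := HH a i (ModuleCat.of R N)

variable {N N' N'' : Type u} [AddCommGroup N] [Module R N] [AddCommGroup N'] [Module R N']
  [AddCommGroup N''] [Module R N'']

instance (a : Ideal R) (i : ℕ) : AddCommGroup (H a i N) :=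
  inferInstanceAs (AddCommGroup (HH a i (ModuleCat.of R N)))
instance (a : Ideal R) (i : ℕ) : Module R (H a i N) :=
  inferInstanceAs (Module R (HH a i (ModuleCat.of R N)))

/-- functoriality -/
def Hm (a : Ideal R) (i : ℕ) (f : N →ₗ[R] N') : H a i N →ₗ[R] H a i N' := (HHm a i (ModuleCat.ofHom f)).hom

lemma Hm_id (a : Ideal R) (i : ℕ) : Hm a i (LinearMap.id : N →ₗ[R] N) = LinearMap.id := by
  have := HHm_id a i (ModuleCat.of R N)
  exact congrArg ModuleCat.Hom.hom this

lemma Hm_comp (a : Ideal R) (i : ℕ) (f : N →ₗ[R] N') (g : N' →ₗ[R] N'') :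
    Hm a i (g ∘ₗ f) = Hm a i g ∘ₗ Hm a i f :=
  congrArg ModuleCat.Hom.hom (HHm_comp a i (ModuleCat.ofHom f) (ModuleCat.ofHom g))

lemma Hm_add (a : Ideal R) (i : ℕ) (f g : N →ₗ[R] N') : Hm a i (f + g) = Hm a i f + Hm a i g :=
  congrArg ModuleCat.Hom.hom (HHm_add a i (ModuleCat.ofHom f) (ModuleCat.ofHom g))

lemma Hm_smul (a : Ideal R) (i : ℕ) (r : R) (f : N →ₗ[R] N') : Hm a i (r • f) = r • Hm a i f :=
  congrArg ModuleCat.Hom.hom (HHm_smul a i r (ModuleCat.ofHom f))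

lemma Hm_zero (a : Ideal R) (i : ℕ) : Hm a i (0 : N →ₗ[R] N') = 0 := by
  have := Hm_smul a i 0 (0 : N →ₗ[R] N')
  rwa [zero_smul, zero_smul] at this

lemma Hm_smul_id (a : Ideal R) (i : ℕ) (r : R) : Hm a i (r • (LinearMap.id : N →ₗ[R] N)) = r • LinearMap.id := by
  rw [Hm_smul, Hm_id]

lemma Hm_lsmul (a : Ideal R) (i : ℕ) (r : R) (z : H a i N) : Hm a i (LinearMap.lsmul R N r) z = r • z := by
  have h : LinearMap.lsmul R N r = r • LinearMap.id := by ext; rfl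
  rw [h, Hm_smul_id]; rfl

lemma H_sub (a : Ideal R) (i : ℕ) [Subsingleton N] : Subsingleton (H a i N) := by
  refine ⟨fun x y => ?_⟩
  have h : (LinearMap.id : N →ₗ[R] N) = 0 := Subsingleton.elim _ _
  have h2 := Hm_id (N := N) a i
  rw [h, Hm_zero] at h2
  have hx := congrArg (fun f => f x) h2
  have hy := congrArg (fun f => f y) h2
  exact hx.symm.trans hy

lemma H_les (a : Ideal R) (f : N →ₗ[R] N') (g : N' →ₗ[R] N'') (hf : Function.Injective f)
    (hg : Function.Surjective g) (hfg : Function.Exact f g) (i : ℕ) :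
    ∃ δ : H a i N'' →ₗ[R] H a (i+1) N, Function.Exact (Hm a i f) (Hm a i g) ∧
      Function.Exact (Hm a i g) δ ∧ Function.Exact δ (Hm a (i+1) f) := by
  let S : ShortComplex (ModuleCat.{u} R) := ShortComplex.mk (ModuleCat.ofHom f) (ModuleCat.ofHom g) (by
    ext x
    exact (hfg _).2 ⟨x, rfl⟩)
  have hS : S.ShortExact := by
    refine ShortComplex.ShortExact.mk' ?_ ?_ ?_
    · rw [ShortComplex.moduleCat_exact_iff]
      intro x hx
      exact (hfg x).1 hx
    · rw [ModuleCat.mono_iff_injective]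
      exact hf
    · rw [ModuleCat.epi_iff_surjective]
      exact hg
  refine ⟨(HHδ a hS i).hom, ?_, ?_, ?_⟩
  · intro z
    refine ⟨fun h => ex2 a hS i z h, ?_⟩
    rintro ⟨y, rfl⟩
    rw [← LinearMap.comp_apply, ← Hm_comp, hfg.linearMap_comp_eq_zero, Hm_zero]; rfl
  · intro z
    refine ⟨fun h => ex3 a hS i z h, ?_⟩
    rintro ⟨y, rfl⟩
    exact ex31 a hS i y
  · intro z
    refine ⟨fun h => ex1 a hS i z h, ?_⟩
    rintro ⟨y, rfl⟩
    exact ex12 a hS i y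

/-- epsilon -/
def eps (a : Ideal R) : H a 0 N →ₗ[R] N := (εH a (ModuleCat.of R N)).hom

lemma eps_inj (a : Ideal R) : Function.Injective (eps a : H a 0 N →ₗ[R] N) := εH_inj a _

lemma eps_tors (a : Ideal R) (z : H a 0 N) : ∃ t, ∀ r ∈ a ^ t, r • eps a z = 0 := εH_tors a _ z

lemma eps_surj (a : Ideal R) (y : N) (t : ℕ) (h : ∀ r ∈ a ^ t, r • y = 0) : ∃ z : H a 0 N, eps a z = y :=
  εH_surj a (ModuleCat.of R N) y t h

lemma eps_nat (a : Ideal R) (f : N →ₗ[R] N') (z : H a 0 N) : eps a (Hm a 0 f z) = f (eps a z) :=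
  capp (εH_nat a (ModuleCat.ofHom f)) z

lemma H_inj (a : Ideal R) (i : ℕ) [Module.Injective R N] : Subsingleton (H a (i+1) N) := by
  have := Module.injective_object_of_injective_module R N
  exact ⟨fun x y => (HH_injective a i (ModuleCat.of R N) x).trans (HH_injective a i (ModuleCat.of R N) y).symm⟩

variable (N) in
lemma exists_inj : ∃ (J : Type u) (_ : AddCommGroup J) (_ : Module R J) (f : N →ₗ[R] J),
    Module.Injective R J ∧ Function.Injective f := by
  refine ⟨(Injective.under (ModuleCat.of R N) : ModuleCat.{u} R), inferInstance, inferInstance,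
    (Injective.ι (ModuleCat.of R N)).hom, ?_, ?_⟩
  · have : Injective (ModuleCat.of R (Injective.under (ModuleCat.of R N) : ModuleCat.{u} R)) :=
      inferInstanceAs (Injective (Injective.under (ModuleCat.of R N)))
    exact Module.injective_module_of_injective_object R _
  · exact (ModuleCat.mono_iff_injective _).1 inferInstance

/-- power torsion -/
def Tors (a : Ideal R) (N : Type u) [AddCommGroup N] [Module R N] : Prop :=
  ∀ x : N, ∃ t, ∀ r ∈ a ^ t, r • x = 0

lemma Tors.of_inj {a : Ideal R} (f : N →ₗ[R] N') (hf : Function.Injective f) (h : Tors a N') : Tors a N := by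
  intro x
  obtain ⟨t, ht⟩ := h (f x)
  refine ⟨t, fun r hr => hf ?_⟩
  rw [map_smul, ht r hr, map_zero]

lemma Tors.of_surj {a : Ideal R} (f : N →ₗ[R] N') (hf : Function.Surjective f) (h : Tors a N) : Tors a N' := by
  intro x
  obtain ⟨x, rfl⟩ := hf x
  obtain ⟨t, ht⟩ := h x
  refine ⟨t, fun r hr => ?_⟩
  rw [← map_smul, ht r hr, map_zero]

/-- torsion submodule -/
def Gam (a : Ideal R) (N : Type u) [AddCommGroup N] [Module R N] : Submodule R N where
  carrier := {x | ∃ t, ∀ r ∈ a ^ t, r • x = 0}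
  zero_mem' := ⟨0, by simp⟩
  add_mem' := by
    rintro x y ⟨s, hs⟩ ⟨t, ht⟩
    refine ⟨s + t, fun r hr => ?_⟩
    rw [smul_add, hs r (Ideal.pow_le_pow_right (by lia) hr), ht r (Ideal.pow_le_pow_right (by lia) hr), add_zero]
  smul_mem' := by
    rintro c x ⟨s, hs⟩
    exact ⟨s, fun r hr => by rw [smul_comm, hs r hr, smul_zero]⟩

lemma mem_Gam {a : Ideal R} {x : N} : x ∈ Gam a N ↔ ∃ t, ∀ r ∈ a ^ t, r • x = 0 := Iff.rfl

lemma Gam_tors (a : Ideal R) : Tors a (Gam a N) := by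
  rintro ⟨x, t, ht⟩
  exact ⟨t, fun r hr => Subtype.ext (ht r hr)⟩

lemma Tors_H (a : Ideal R) (i : ℕ) : ∀ (N : Type u) [AddCommGroup N] [Module R N], Tors a (H a i N) := by
  induction i with
  | zero => 
    intro N _ _ z
    obtain ⟨t, ht⟩ := eps_tors a z
    refine ⟨t, fun r hr => eps_inj a ?_⟩
    rw [map_smul, ht r hr, map_zero]
  | succ i ih =>
    intro N _ _
    obtain ⟨J, _, _, f, hJ, hf⟩ := exists_inj (R := R) N
    obtain ⟨δ, -, -, h⟩ := H_les a f (LinearMap.range f).mkQ hf (Submodule.mkQ_surjective _)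
      (LinearMap.exact_map_mkQ_range f) i
    refine Tors.of_surj δ ?_ (ih _)
    intro z
    have := H_inj (N := J) a i
    exact (h z).1 (Subsingleton.elim _ _)

lemma inj_ext {X Y J : Type u} [AddCommGroup X] [Module R X] [AddCommGroup Y] [Module R Y] [AddCommGroup J]
    [Module R J] [Module.Injective R J] (ψ : X →ₗ[R] Y) (g : X →ₗ[R] J) (h : LinearMap.ker ψ ≤ LinearMap.ker g) :
    ∃ k : Y →ₗ[R] J, ∀ x, k (ψ x) = g x := by
  obtain ⟨k, hk⟩ := Module.Injective.out ((LinearMap.ker ψ).liftQ ψ le_rfl)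
    (by rw [← LinearMap.ker_eq_bot]; exact Submodule.ker_liftQ_eq_bot _ _ _ le_rfl) ((LinearMap.ker ψ).liftQ g h)
  refine ⟨k, fun x => ?_⟩
  have := hk (Submodule.Quotient.mk x)
  simpa using this

lemma fg_tors {a : Ideal R} (h : Tors a N) [Module.Finite R N] : ∃ t, ∀ r ∈ a ^ t, ∀ x : N, r • x = 0 := by
  obtain ⟨s, hs⟩ := Module.Finite.fg_top (R := R) (M := N)
  choose t ht using h
  refine ⟨s.sup t, fun r hr x => ?_⟩
  have hx : x ∈ Submodule.span R (s : Set N) := by rw [hs]; trivial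
  induction hx using Submodule.span_induction with
  | mem x hx => exact ht x r (Ideal.pow_le_pow_right (Finset.le_sup hx) hr)
  | zero => simp
  | add x y _ _ h1 h2 => rw [smul_add, h1, h2, add_zero]
  | smul c x _ h => rw [smul_comm, h, smul_zero]

lemma Gam_inj [IsNoetherianRing R] (a : Ideal R) (J : Type u) [AddCommGroup J] [Module R J]
    [Module.Injective R J] : Module.Injective R (Gam a J) := by
  apply Module.Baer.injective
  intro I g
  have h1 : Tors a (LinearMap.range g) := Tors.of_inj (Submodule.subtype _) (Subtype.val_injective) (Gam_tors a)
  obtain ⟨t, ht⟩ := fg_tors h1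
  obtain ⟨k, hk⟩ := Ideal.exists_pow_inf_eq_pow_smul a (I : Submodule R R)
  have hk := hk (k + t) (by lia)
  rw [Nat.add_sub_cancel_left] at hk
  have hker : LinearMap.ker ((a ^ (k+t)).mkQ ∘ₗ I.subtype) ≤ LinearMap.ker ((Gam a J).subtype ∘ₗ g) := by
    intro x hx
    rw [LinearMap.mem_ker, LinearMap.comp_apply, Submodule.mkQ_apply, Submodule.Quotient.mk_eq_zero] at hx
    have hx2 : (x : R) ∈ a ^ t • (a ^ k • (⊤ : Submodule R R) ⊓ (I : Submodule R R)) := by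
      rw [← hk]
      refine ⟨?_, x.2⟩
      simpa using hx
    have hx3 : (x : R) ∈ a ^ t • (I : Submodule R R) := (Submodule.smul_mono le_rfl inf_le_right) hx2
    have hx4 : x ∈ a ^ t • (⊤ : Submodule R I) := by
      have : (a ^ t • (⊤ : Submodule R I)).map I.subtype = a ^ t • (I : Submodule R R) := by
        rw [Submodule.map_smul'', Submodule.map_top, Submodule.range_subtype]
      rw [← this] at hx3
      obtain ⟨y, hy, hxy⟩ := hx3
      have : y = x := Subtype.ext hxy
      rwa [← this]
    have hx5 : g x = 0 := by
      refine Submodule.smul_induction_on hx4 ?_ ?_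
      · intro r hr n _
        have := ht r hr ⟨g n, n, rfl⟩
        rw [map_smul]
        exact congrArg Subtype.val this
      · intro x y hx hy
        rw [map_add, hx, hy, add_zero]
    rw [LinearMap.mem_ker, LinearMap.comp_apply, hx5, map_zero]
  obtain ⟨h, hh⟩ := inj_ext _ _ hker
  refine ⟨(h ∘ₗ (a ^ (k+t)).mkQ).codRestrict (Gam a J) ?_, ?_⟩
  · intro c
    refine ⟨k+t, fun r hr => ?_⟩
    rw [← map_smul, LinearMap.comp_apply]
    have : (a ^ (k+t)).mkQ (r • c) = 0 := by
      rw [Submodule.mkQ_apply, Submodule.Quotient.mk_eq_zero]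
      exact Ideal.mul_mem_right _ _ hr
    rw [this, map_zero]
  · intro x hx
    apply Subtype.ext
    exact hh ⟨x, hx⟩

lemma H_tors_zero [IsNoetherianRing R] (a : Ideal R) (i : ℕ) : ∀ (N : Type u) [AddCommGroup N] [Module R N],
    Tors a N → Subsingleton (H a (i+1) N) := by
  induction i with
  | zero =>
    intro N _ _ hN
    obtain ⟨J, _, _, f, hJ, hf⟩ := exists_inj (R := R) N
    let f' : N →ₗ[R] Gam a J := f.codRestrict _ (fun x => by
      obtain ⟨t, ht⟩ := hN x
      exact ⟨t, fun r hr => by rw [← map_smul, ht r hr, map_zero]⟩)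
    have hf' : Function.Injective f' := fun x y h => hf (congrArg Subtype.val h)
    have := Gam_inj a J
    obtain ⟨δ, -, h1, h2⟩ := H_les a f' (LinearMap.range f').mkQ hf' (Submodule.mkQ_surjective _)
      (LinearMap.exact_map_mkQ_range f') 0
    have hz : ∀ z : H a (0+1) N, z = 0 := by
      intro z
      have := H_inj (N := Gam a J) a 0
      obtain ⟨w, rfl⟩ := (h2 z).1 (Subsingleton.elim _ _)
      rw [h1 w]
      obtain ⟨x, hx⟩ := Submodule.mkQ_surjective _ (eps a w)
      obtain ⟨t, ht⟩ := Gam_tors a x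
      obtain ⟨z, hz⟩ := eps_surj a x t ht
      refine ⟨z, eps_inj a ?_⟩
      rw [eps_nat, hz, hx]
    exact ⟨fun x y => (hz x).trans (hz y).symm⟩
  | succ i ih =>
    intro N _ _ hN
    obtain ⟨J, _, _, f, hJ, hf⟩ := exists_inj (R := R) N
    let f' : N →ₗ[R] Gam a J := f.codRestrict _ (fun x => by
      obtain ⟨t, ht⟩ := hN x
      exact ⟨t, fun r hr => by rw [← map_smul, ht r hr, map_zero]⟩)
    have hf' : Function.Injective f' := fun x y h => hf (congrArg Subtype.val h)
    have := Gam_inj a J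
    obtain ⟨δ, -, h1, h2⟩ := H_les a f' (LinearMap.range f').mkQ hf' (Submodule.mkQ_surjective _)
      (LinearMap.exact_map_mkQ_range f') (i+1)
    have hz : ∀ z : H a (i+1+1) N, z = 0 := by
      intro z
      have := H_inj (N := Gam a J) a (i+1)
      obtain ⟨w, rfl⟩ := (h2 z).1 (Subsingleton.elim _ _)
      have := ih (Gam a J ⧸ LinearMap.range f') (Tors.of_surj _ (Submodule.mkQ_surjective _) (Gam_tors a))
      rw [Subsingleton.elim w 0, map_zero]
    exact ⟨fun x y => (hz x).trans (hz y).symm⟩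

/-- the comparison with local cohomology -/
def LCequiv (a : Ideal R) (i : ℕ) (N : Type u) [AddCommGroup N] [Module R N] :
   ((localCohomology a i).obj (ModuleCat.of R N)) ≃ₗ[R] H a i N := (LCiso a i (ModuleCat.of R N)).toLinearEquiv

end LCproof


namespace LCproof
open scoped Pointwise

variable {R : Type u} [CommRing R]
variable {N N' N'' : Type u} [AddCommGroup N] [Module R N] [AddCommGroup N'] [Module R N']
  [AddCommGroup N''] [Module R N'']

lemma exists_regular [IsNoetherianRing R] [Module.Finite R N] (a : Ideal R) (h : Gam a N = ⊥) :
    ∃ x ∈ a, IsSMulRegular N x := by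
  by_contra hcon
  push Not at hcon
  have h1 : (a : Set R) ⊆ ⋃ p ∈ associatedPrimes R N, p := by
    intro x hx
    rw [biUnion_associatedPrimes_eq_zero_divisors]
    have := hcon x hx
    rw [isSMulRegular_iff_right_eq_zero_of_smul] at this
    push Not at this
    obtain ⟨y, h1, h2⟩ := this
    exact ⟨y, h2, h1⟩
  have hfin := associatedPrimes.finite R N
  have h2 : (a : Set R) ⊆ ⋃ p ∈ (↑hfin.toFinset : Set (Ideal R)), ((id p : Ideal R) : Set R) := by
    simpa using h1
  rw [Ideal.subset_union_prime (f := id) (s := hfin.toFinset) ⊥ ⊥ (by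
    intro i hi _ _
    have : i ∈ associatedPrimes R N := by simpa using hi
    exact this.isPrime)] at h2
  obtain ⟨p, hp, hap⟩ := h2
  have hp : p ∈ associatedPrimes R N := by simpa using hp
  rw [AssociatedPrimes.mem_iff, isAssociatedPrime_iff] at hp
  obtain ⟨hpp, y, hy⟩ := hp
  have hyG : y ∈ Gam a N := by
    refine ⟨1, fun r hr => ?_⟩
    rw [pow_one] at hr
    have := hap hr
    rw [id, hy] at this
    simpa using this
  rw [h] at hyG
  have : y = 0 := by simpa using hyG
  subst this
  apply hpp.ne_top
  rw [hy, eq_top_iff]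
  intro r _
  simp

lemma Gam_quot [IsNoetherianRing R] [Module.Finite R N] (a : Ideal R) : Gam a (N ⧸ Gam a N) = ⊥ := by
  rw [eq_bot_iff]
  intro x hx
  obtain ⟨x, rfl⟩ := Submodule.mkQ_surjective _ x
  obtain ⟨t, ht⟩ := hx
  have h1 : ∀ r ∈ a ^ t, r • x ∈ Gam a N := by
    intro r hr
    have := ht r hr
    rw [← map_smul, Submodule.mkQ_apply, Submodule.Quotient.mk_eq_zero] at this
    exact this
  obtain ⟨s, hs⟩ := fg_tors (Gam_tors (N := N) a)
  have : x ∈ Gam a N := by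
    refine ⟨s + t, fun r hr => ?_⟩
    rw [pow_add] at hr
    refine Submodule.mul_induction_on hr ?_ ?_
    · intro m hm n hn
      rw [mul_smul]
      exact congrArg Subtype.val (hs m hm ⟨n • x, h1 n hn⟩)
    · intro p q hp hq
      rw [add_smul, hp, hq, add_zero]
  simpa using this

/-- removing torsion does not change higher cohomology -/
lemma H_red_bij [IsNoetherianRing R] (a : Ideal R) (i : ℕ) :
    Function.Bijective (Hm a (i+1) (Gam a N).mkQ) := by
  have hex : Function.Exact (Gam a N).subtype (Gam a N).mkQ := LinearMap.exact_subtype_mkQ _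
  have s1 := H_tors_zero a i _ (Gam_tors (N := N) a)
  have s2 := H_tors_zero a (i+1) _ (Gam_tors (N := N) a)
  obtain ⟨δ, h1, h2, -⟩ := H_les a (Gam a N).subtype (Gam a N).mkQ Subtype.val_injective
    (Submodule.mkQ_surjective _) hex (i+1)
  constructor
  · rw [injective_iff_map_eq_zero]
    intro z hz
    obtain ⟨y, rfl⟩ := (h1 z).1 hz
    rw [Subsingleton.elim y 0, map_zero]
  · intro z
    exact (h2 z).1 (Subsingleton.elim _ _)

lemma H_mulx (a : Ideal R) (x : R) (hx : IsSMulRegular N x) (i : ℕ) :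
    ∃ δ : H a i (QuotSMulTop x N) →ₗ[R] H a (i+1) N,
      Function.Exact δ (fun z : H a (i+1) N => x • z) ∧
      Function.Exact (fun z : H a i N => x • z) (Hm a i (Submodule.mkQ (x • (⊤ : Submodule R N)))) ∧
      Function.Exact (Hm a i (Submodule.mkQ (x • (⊤ : Submodule R N)))) δ := by
  have hex : Function.Exact (LinearMap.lsmul R N x) (Submodule.mkQ (x • (⊤ : Submodule R N))) := by
    intro y
    rw [Submodule.mkQ_apply, Submodule.Quotient.mk_eq_zero, Submodule.mem_smul_pointwise_iff_exists]
    constructor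
    · rintro ⟨b, _, hb⟩
      exact ⟨b, hb⟩
    · rintro ⟨b, hb⟩
      exact ⟨b, trivial, hb⟩
  obtain ⟨δ, h1, h2, h3⟩ := H_les a (LinearMap.lsmul R N x) (Submodule.mkQ (x • (⊤ : Submodule R N))) hx
    (Submodule.mkQ_surjective _) hex i
  have e1 : (fun z : H a (i+1) N => x • z) = Hm a (i+1) (LinearMap.lsmul R N x) := by
    funext z; rw [Hm_lsmul]
  have e2 : (fun z : H a i N => x • z) = Hm a i (LinearMap.lsmul R N x) := by
    funext z; rw [Hm_lsmul]
  exact ⟨δ, e1 ▸ h3, e2 ▸ h1, h2⟩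

lemma tors_eq_zero {a : Ideal R} (hT : Tors a N) {x : R} (hx : x ∈ a) (hi : ∀ z : N, x • z = 0 → z = 0) (z : N) :
    z = 0 := by
  obtain ⟨t, ht⟩ := hT z
  have h := ht (x ^ t) (Ideal.pow_mem_pow hx t)
  clear ht
  induction t with
  | zero => simpa using h
  | succ t ih =>
    apply ih
    apply hi
    rw [← mul_smul, ← pow_succ', h]

lemma dim_quot_lt [IsNoetherianRing R] [Module.Finite R N] {x : R} (hx : IsSMulRegular N x) {d : ℕ}
    (h : Module.supportDim R N < (d + 1 : ℕ)) : Module.supportDim R (QuotSMulTop x N) < d := by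
  have h1 := Module.supportDim_quotSMulTop_succ_le_of_notMem_minimalPrimes (R := R) (M := N) (x := x)
    (fun _ => hx.notMem_of_mem_minimalPrimes)
  by_contra hc
  push Not at hc
  have h2 : ((d + 1 : ℕ) : WithBot ℕ∞) ≤ Module.supportDim R (QuotSMulTop x N) + 1 := by
    push_cast
    gcongr
  exact absurd h (not_lt.2 (h2.trans h1))

lemma dim_red_lt (a : Ideal R) {d : WithBot ℕ∞}
    (h : Module.supportDim R N < d) : Module.supportDim R (N ⧸ Gam a N) < d :=
  lt_of_le_of_lt (Module.supportDim_le_of_surjective _ (Submodule.mkQ_surjective _)) h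

/-- Grothendieck vanishing -/
lemma H_vanish [IsNoetherianRing R] (a : Ideal R) (d : ℕ) : ∀ (N : Type u) [AddCommGroup N] [Module R N]
    [Module.Finite R N], Module.supportDim R N < d → ∀ i, d ≤ i → Subsingleton (H a i N) := by
  induction d with
  | zero =>
    intro N _ _ _ h i _
    have : Module.supportDim R N = ⊥ := by
      by_contra hc
      have : Nontrivial N := (Module.supportDim_ne_bot_iff_nontrivial R N).1 hc
      have h2 : Nonempty (Module.support R N) := Module.nonempty_support_of_nontrivial.to_subtype
      have : (0 : WithBot ℕ∞) ≤ Module.supportDim R N := Order.krullDim_nonneg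
      exact absurd h (not_lt.2 (by simpa using this))
    have := (Module.supportDim_eq_bot_iff_subsingleton R N).1 this
    exact H_sub a i
  | succ d ih =>
    intro N _ _ _ h i hi
    obtain ⟨j, rfl⟩ : ∃ j, i = j + 1 := ⟨i - 1, by lia⟩
    obtain ⟨x, hxa, hx⟩ := exists_regular a (Gam_quot (N := N) a)
    have h2 := ih (QuotSMulTop x (N ⧸ Gam a N)) (dim_quot_lt hx (dim_red_lt a h)) j (by lia)
    obtain ⟨δ, h3, -, -⟩ := H_mulx a x hx j
    have hz : ∀ z : H a (j+1) (N ⧸ Gam a N), z = 0 := by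
      apply tors_eq_zero (Tors_H a _ _) hxa
      intro z hz
      obtain ⟨y, rfl⟩ := (h3 z).1 hz
      rw [Subsingleton.elim y 0, map_zero]
    refine ⟨fun u v => (H_red_bij a j).1 ?_⟩
    rw [hz (Hm a (j+1) (Gam a N).mkQ u), hz (Hm a (j+1) (Gam a N).mkQ v)]

end LCproof


namespace LCproof

/-- completion of a surjection -/
lemma compl_surj {P S : Type u} [CommRing P] [CommRing S] (g : P →+* S) (hg : Function.Surjective g)
    (J : Ideal P) (I : Ideal S) (hJ : J.FG) (hJI : J.map g = I) :
    ∃ F : AdicCompletion J P →+* AdicCompletion I S, Function.Surjective F := by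
  have hI : I.FG := hJI ▸ hJ.map g
  have hle : ∀ n, J ^ n ≤ (I ^ n).comap g := fun n => by
    rw [← Ideal.map_le_iff_le_comap, Ideal.map_pow, hJI]
  let f : (n : ℕ) → AdicCompletion J P →+* S ⧸ I ^ n := fun n =>
    (Ideal.quotientMap (I ^ n) g (hle n)).comp (AdicCompletion.evalₐ J n : _ →+* _)
  have hf : ∀ {m n : ℕ} (hle : m ≤ n), (Ideal.Quotient.factorPow I hle).comp (f n) = f m := by
    intro m n h
    ext x
    induction x using AdicCompletion.induction_on with
    | _ x =>
    simp only [f, RingHom.comp_apply, RingHom.coe_coe, AdicCompletion.evalₐ_mk, Ideal.quotientMap_mk]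
    change Ideal.Quotient.mk _ _ = _
    rw [← Ideal.quotientMap_mk (H := hle m), ← Ideal.quotientMap_mk (H := hle m), AdicCompletion.Ideal.mk_eq_mk J h]
  let F := AdicCompletion.liftRingHom I f hf
  have hF : F.comp (algebraMap P _) = (algebraMap S _).comp g := by
    refine RingHom.ext fun x => ?_
    apply AdicCompletion.ext_evalₐ
    intro n
    simp only [F, RingHom.comp_apply, AdicCompletion.evalₐ_liftRingHom, f, RingHom.coe_coe, AlgHom.commutes]
    change Ideal.quotientMap _ _ _ (Ideal.Quotient.mk _ x) = Ideal.Quotient.mk _ _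
    rw [Ideal.quotientMap_mk]
  refine ⟨F, ?_⟩
  have e1 : (J.map (algebraMap P (AdicCompletion J P))).map F = I.map (algebraMap S (AdicCompletion I S)) := by
    rw [Ideal.map_map, hF, ← Ideal.map_map, hJI]
  have c1 := AdicCompletion.isAdicComplete_self J hJ
  have c2 := AdicCompletion.isAdicComplete_self I hI
  have c3 : IsHausdorff ((J.map (algebraMap P (AdicCompletion J P))).map F) (AdicCompletion I S) := by
    rw [e1]; infer_instance
  apply surjective_of_mk_map_comp_surjective (I := J.map (algebraMap P (AdicCompletion J P))) F
  intro y
  obtain ⟨y, rfl⟩ := Ideal.Quotient.mk_surjective y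
  obtain ⟨s, hs⟩ := Ideal.Quotient.mk_surjective (AdicCompletion.evalOneₐ I y)
  obtain ⟨p, rfl⟩ := hg s
  refine ⟨algebraMap P _ p, ?_⟩
  rw [RingHom.comp_apply, Ideal.Quotient.mk_eq_mk_iff_sub_mem, e1, ← RingHom.comp_apply, hF,
    ← AdicCompletion.ker_evalOneₐ_eq_map I hI, RingHom.mem_ker, map_sub, RingHom.comp_apply]
  rw [sub_eq_zero]
  exact (AlgHom.commutes (AdicCompletion.evalOneₐ I) (g p)).trans hs

lemma compl_noeth (S : Type u) [CommRing S] [IsNoetherianRing S] (I : Ideal S) :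
    IsNoetherianRing (AdicCompletion I S) := by
  obtain ⟨s, hs⟩ := I.fg_of_isNoetherianRing
  let g : MvPolynomial s S →+* S := MvPolynomial.eval₂Hom (RingHom.id S) (fun i => (i : S))
  have hg : Function.Surjective g := fun x => ⟨MvPolynomial.C x, by simp [g]⟩
  have hJI : (MvPolynomial.idealOfVars s S).map g = I := by
    rw [MvPolynomial.idealOfVars, Ideal.map_span, ← Set.range_comp, ← hs]
    congr 1
    ext x
    simp [g]
  obtain ⟨F, hF⟩ := compl_surj g hg _ I (MvPolynomial.idealOfVars_fg s S) hJI
  have : IsNoetherianRing (AdicCompletion (MvPolynomial.idealOfVars s S) (MvPolynomial s S)) :=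
    isNoetherianRing_of_ringEquiv _ (MvPowerSeries.toAdicCompletionAlgEquiv s S).toRingEquiv
  exact isNoetherianRing_of_surjective _ _ F hF

end LCproof


namespace LCproof

variable {A : Type u} [CommRing A]

/-- injective hull of a submodule of an injective module -/
lemma hull_aux {J : Type u} [AddCommGroup J] [Module A J] [hJ : Module.Injective A J] (K : Submodule A J) :
    ∃ E : Submodule A J, K ≤ E ∧ (∀ x ∈ E, x ≠ 0 → ∃ r : A, r • x ∈ K ∧ r • x ≠ 0) ∧ Module.Injective A E := by
  let s : Set (Submodule A J) := {E | ∀ x ∈ E, x ≠ 0 → ∃ r : A, r • x ∈ K ∧ r • x ≠ 0}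
  obtain ⟨E, hKE, hE⟩ := zorn_le_nonempty₀ s (by
    intro c hc hch y hy
    refine ⟨sSup c, ?_, fun z hz => le_sSup hz⟩
    intro x hx hx0
    rw [Submodule.mem_sSup_of_directed ⟨y, hy⟩ hch.directedOn] at hx
    obtain ⟨E', hE', hx⟩ := hx
    exact hc hE' x hx hx0) K (by
      intro x hx hx0
      exact ⟨1, by simpa using hx, by simpa using hx0⟩)
  let s' : Set (Submodule A J) := {C | ∀ x ∈ C, x ∈ E → x = 0}
  obtain ⟨C, -, hC⟩ := zorn_le_nonempty₀ s' (by
    intro c hc hch y hy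
    refine ⟨sSup c, ?_, fun z hz => le_sSup hz⟩
    intro x hx hx0
    rw [Submodule.mem_sSup_of_directed ⟨y, hy⟩ hch.directedOn] at hx
    obtain ⟨E', hE', hx⟩ := hx
    exact hc hE' x hx hx0) ⊥ (by
      intro x hx _
      simpa using hx)
  have hC' : ∀ y : J, y ∉ C → ∃ r : A, ∃ e ∈ E, e ≠ 0 ∧ r • y - e ∈ C := by
    intro y hy
    by_contra hcon
    push Not at hcon
    have h1 : C ⊔ Submodule.span A {y} ∈ s' := by
      intro x hx hxE
      obtain ⟨c, hc, z, hz, rfl⟩ := Submodule.mem_sup.1 hx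
      obtain ⟨r, rfl⟩ := Submodule.mem_span_singleton.1 hz
      by_contra h0
      apply hcon r _ hxE h0
      have : r • y - (c + r • y) = -c := by abel
      rw [this]
      exact C.neg_mem hc
    have h2 := hC.2 h1 le_sup_left
    exact hy (h2 (Submodule.mem_sup_right (Submodule.mem_span_singleton_self y)))
  obtain ⟨h, hh⟩ := inj_ext (C.mkQ ∘ₗ E.subtype) E.subtype (by
    intro x hx
    rw [LinearMap.mem_ker, LinearMap.comp_apply, Submodule.mkQ_apply, Submodule.Quotient.mk_eq_zero] at hx
    rw [LinearMap.mem_ker]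
    exact hC.1 _ hx x.2)
  have key : ∀ y : J, y ∉ C → ∃ r : A, ∃ e ∈ E, e ≠ 0 ∧ r • h (C.mkQ y) = e := by
    intro y hy
    obtain ⟨r, e, he, he0, hc⟩ := hC' y hy
    refine ⟨r, e, he, he0, ?_⟩
    rw [← map_smul, ← map_smul]
    have : C.mkQ (r • y) = C.mkQ e := by
      rw [← sub_eq_zero, ← map_sub, Submodule.mkQ_apply, Submodule.Quotient.mk_eq_zero]
      exact hc
    rw [this]
    exact hh ⟨e, he⟩
  have hr : LinearMap.range h ∈ s := by
    rintro _ ⟨y, rfl⟩ hy0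
    obtain ⟨y, rfl⟩ := Submodule.mkQ_surjective _ y
    have hy : y ∉ C := by
      intro hy
      apply hy0
      rw [Submodule.mkQ_apply, (Submodule.Quotient.mk_eq_zero C).2 hy, map_zero]
    obtain ⟨r, e, he, he0, hre⟩ := key y hy
    obtain ⟨t, ht, ht0⟩ := hE.1 e he he0
    exact ⟨t * r, by rw [mul_smul, hre]; exact ht, by rw [mul_smul, hre]; exact ht0⟩
  have hEr : E ≤ LinearMap.range h := fun e he => ⟨_, hh ⟨e, he⟩⟩
  have hrE := hE.2 hr hEr
  let π : J →ₗ[A] E := (h ∘ₗ C.mkQ).codRestrict E (fun y => hrE ⟨_, rfl⟩)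
  refine ⟨E, hKE, hE.1, ⟨?_⟩⟩
  intro X Y _ _ _ _ f hf g
  obtain ⟨k, hk⟩ := hJ.out f hf (E.subtype ∘ₗ g)
  refine ⟨π ∘ₗ k, fun x => ?_⟩
  rw [LinearMap.comp_apply, hk]
  apply Subtype.ext
  exact hh (g x)

lemma exists_hull (A : Type u) [CommRing A] [IsLocalRing A] :
    ∃ (E : Type u) (_ : AddCommGroup E) (_ : Module A E), Module.Injective A E ∧ ∃ ε : E, ε ≠ 0 ∧
      (∀ r ∈ IsLocalRing.maximalIdeal A, r • ε = 0) ∧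
      ∀ e : E, (∀ r ∈ IsLocalRing.maximalIdeal A, r • e = 0) → ∃ r : A, e = r • ε := by
  obtain ⟨J, _, _, f, hJ, hf⟩ := exists_inj (R := A) (A ⧸ IsLocalRing.maximalIdeal A)
  obtain ⟨E, hKE, hess, hE⟩ := hull_aux (LinearMap.range f)
  refine ⟨E, inferInstance, inferInstance, hE, ⟨f 1, hKE ⟨1, rfl⟩⟩, ?_, ?_, ?_⟩
  · intro h
    have h2 := congrArg Subtype.val h
    have h3 : f 1 = f 0 := by rw [map_zero]; exact h2
    exact one_ne_zero (hf h3)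
  · intro r hr
    apply Subtype.ext
    change r • f 1 = 0
    rw [← map_smul]
    have : r • (1 : A ⧸ IsLocalRing.maximalIdeal A) = 0 := by
      change Ideal.Quotient.mk _ (r • 1) = 0
      rw [Ideal.Quotient.eq_zero_iff_mem]
      simpa using hr
    rw [this, map_zero]
  · intro e he
    by_cases h0 : e = 0
    · exact ⟨0, by simp [h0]⟩
    obtain ⟨r, ⟨k, hk⟩, hr0⟩ := hess e e.2 (fun h => h0 (Subtype.ext h))
    have hru : IsUnit r := by
      by_contra hr
      exact hr0 (congrArg Subtype.val (he r ((IsLocalRing.mem_maximalIdeal r).2 hr)))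
    obtain ⟨v, rfl⟩ := hru
    obtain ⟨b, rfl⟩ := Ideal.Quotient.mk_surjective k
    refine ⟨(↑v⁻¹ : A) * b, ?_⟩
    apply Subtype.ext
    change (e : J) = ((↑v⁻¹ : A) * b) • f 1
    have : f (Ideal.Quotient.mk _ b) = b • f 1 := by
      rw [← map_smul]
      congr 1
      change _ = Ideal.Quotient.mk _ (b • 1)
      simp
    rw [mul_smul, ← this, hk, ← mul_smul]
    simp

/-- restriction of an injective along a flat map is injective -/
lemma inj_flat {S : Type u} [CommRing S] [Algebra S A] [Module.Flat S A] (E : Type u) [AddCommGroup E] [Module A E]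
    [Module S E] [IsScalarTower S A E] [hE : Module.Injective A E] : Module.Injective S E := by
  constructor
  intro X Y _ _ _ _ f hf g
  obtain ⟨h, hh⟩ := hE.out (f.baseChange A) (Module.Flat.lTensor_preserves_injective_linearMap (M := A) f hf)
    (LinearMap.liftBaseChange A g)
  refine ⟨(h.restrictScalars S) ∘ₗ (TensorProduct.mk S A Y 1), fun x => ?_⟩
  have := hh (TensorProduct.tmul S 1 x)
  simpa using this

end LCproof


namespace LCproof
open scoped Pointwise

section finiteness
variable {A : Type u} [CommRing A]

lemma mem_pi_smul (I : Ideal A) (r : ℕ) (v : Fin r → A) :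
    v ∈ (I • ⊤ : Submodule A (Fin r → A)) ↔ ∀ i, v i ∈ I := by
  constructor
  · intro h i
    refine Submodule.smul_induction_on h ?_ ?_
    · intro s hs n _
      exact I.mul_mem_right _ hs
    · intro x y hx hy
      exact I.add_mem hx hy
  · intro h
    have : v = ∑ i, v i • (Pi.single i (1 : A) : Fin r → A) := by
      conv_lhs => rw [pi_eq_sum_univ' v]
    rw [this]
    exact Submodule.sum_mem _ fun i _ => Submodule.smul_mem_smul (h i) trivial

lemma prec_pi (I : Ideal A) [h : IsPrecomplete I A] (r : ℕ) : IsPrecomplete I (Fin r → A) := by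
  constructor
  intro f hf
  have h1 : ∀ i : Fin r, ∃ L : A, ∀ n, f n i ≡ L [SMOD (I ^ n • ⊤ : Submodule A A)] := by
    intro i
    apply h.prec
    intro m n hmn
    have := hf hmn
    rw [SModEq.sub_mem, mem_pi_smul] at this
    rw [SModEq.sub_mem]
    simpa using this i
  choose L hL using h1
  refine ⟨L, fun n => ?_⟩
  rw [SModEq.sub_mem, mem_pi_smul]
  intro i
  have := hL i n
  rw [SModEq.sub_mem] at this
  simpa using this

lemma fin_of_haus (I : Ideal A) [IsPrecomplete I A] {K : Type u} [AddCommGroup K] [Module A K] [IsHausdorff I K]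
    (r : ℕ) (k : Fin r → K) (h : ∀ z : K, ∃ c : Fin r → A, z - ∑ i, c i • k i ∈ (I • ⊤ : Submodule A K)) :
    Module.Finite A K := by
  have := prec_pi I r
  have hs : Function.Surjective (Fintype.linearCombination A k) := by
    apply surjective_of_mkQ_comp_surjective (I := I)
    intro y
    obtain ⟨y, rfl⟩ := Submodule.mkQ_surjective _ y
    obtain ⟨c, hc⟩ := h y
    refine ⟨c, ?_⟩
    rw [LinearMap.comp_apply, eq_comm, ← sub_eq_zero, ← map_sub, Submodule.mkQ_apply,
      Submodule.Quotient.mk_eq_zero, Fintype.linearCombination_apply]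
    exact hc
  exact Module.Finite.of_surjective _ hs

end finiteness

section setup
variable {A : Type u} [CommRing A] [IsNoetherianRing A]
  [IsLocalRing A] {E : Type u} [AddCommGroup E] [Module A E]

open IsLocalRing

lemma tors_noeth (ε : E) (hs : ∀ e : E, (∀ r ∈ maximalIdeal A, r • e = 0) → ∃ r : A, e = r • ε) (k : ℕ) :
    IsNoetherian A (Submodule.torsionBySet A E ((maximalIdeal A ^ k : Ideal A) : Set A)) := by
  induction k with
  | zero =>
    have : Submodule.torsionBySet A E ((maximalIdeal A ^ 0 : Ideal A) : Set A) = ⊥ := by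
      rw [eq_bot_iff]
      intro x hx
      rw [Submodule.mem_torsionBySet_iff] at hx
      simpa using hx ⟨1, by simp⟩
    rw [this]
    infer_instance
  | succ k ih =>
    obtain ⟨n, g, hg⟩ := Submodule.fg_iff_exists_fin_generating_family.1 (maximalIdeal A).fg_of_isNoetherianRing
    have hgm : ∀ i, g i ∈ maximalIdeal A := fun i => by
      rw [← hg]; exact Submodule.subset_span ⟨i, rfl⟩
    let T := Submodule.torsionBySet A E ((maximalIdeal A ^ (k+1) : Ideal A) : Set A)
    let T' := Submodule.torsionBySet A E ((maximalIdeal A ^ k : Ideal A) : Set A)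
    let F : T →ₗ[A] (Fin n → T') := LinearMap.pi fun i => ((LinearMap.lsmul A E (g i)) ∘ₗ T.subtype).codRestrict T' (by
      intro e
      rw [Submodule.mem_torsionBySet_iff]
      intro r
      have := e.2
      rw [Submodule.mem_torsionBySet_iff] at this
      have h2 := this ⟨r * g i, by rw [pow_succ]; exact Ideal.mul_mem_mul r.2 (hgm i)⟩
      change (r : A) • (g i • (e : E)) = 0
      rw [← mul_smul]; exact h2)
    have hk : LinearMap.ker F ≤ Submodule.comap T.subtype (Submodule.span A {ε}) := by
      intro e he
      have h1 : ∀ i, g i • (e : E) = 0 := by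
        intro i
        have := congrFun he i
        exact congrArg Subtype.val this
      obtain ⟨r, hr⟩ := hs e (by
        intro r hr
        rw [← hg] at hr
        refine Submodule.span_induction ?_ ?_ ?_ ?_ hr
        · rintro _ ⟨i, rfl⟩; exact h1 i
        · simp
        · intro x y _ _ hx hy; rw [add_smul, hx, hy, add_zero]
        · intro a x _ hx; rw [smul_eq_mul, mul_smul, hx, smul_zero])
      change (e : E) ∈ Submodule.span A {ε}
      rw [hr]
      exact Submodule.mem_span_singleton.2 ⟨r, rfl⟩
    have hN : IsNoetherian A (LinearMap.ker F) := by
      let j : LinearMap.ker F →ₗ[A] Submodule.span A {ε} :=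
        (T.subtype ∘ₗ (LinearMap.ker F).subtype).codRestrict _ (fun e => hk e.2)
      refine isNoetherian_of_injective j ?_
      intro x y hxy
      have := congrArg Subtype.val hxy
      exact Subtype.ext (Subtype.ext this)
    exact isNoetherian_of_range_eq_ker (LinearMap.ker F).subtype F (by simp)

end setup

end LCproof


namespace LCproof
open scoped Pointwise
open IsLocalRing

section setup
variable {R A : Type u} [CommRing R] [IsLocalRing R] [CommRing A]
  [IsLocalRing A] [Algebra R A] {E : Type u} [AddCommGroup E] [Module A E] [Module R E] [IsScalarTower R A E]
  {T : Type u} [AddCommGroup T] [Module R T]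

lemma val_zero (hm : (maximalIdeal R).map (algebraMap R A) = maximalIdeal A) (κ : T →ₗ[R] E) (t : T) (k : ℕ)
    (h : ∀ r ∈ maximalIdeal R ^ k, r • t = 0) (s : A) (hs : s ∈ maximalIdeal A ^ k) : s • κ t = 0 := by
  rw [← hm, ← Ideal.map_pow] at hs
  refine Submodule.span_induction ?_ ?_ ?_ ?_ hs
  · rintro _ ⟨r, hr, rfl⟩
    rw [algebraMap_smul, ← map_smul, h r hr, map_zero]
  · simp
  · intro x y _ _ hx hy; rw [add_smul, hx, hy, add_zero]
  · intro a x _ hx; rw [smul_eq_mul, mul_smul, hx, smul_zero]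

lemma K_haus (hm : (maximalIdeal R).map (algebraMap R A) = maximalIdeal A) (hT : Tors (maximalIdeal R) T) :
    IsHausdorff (maximalIdeal A) (T →ₗ[R] E) := by
  constructor
  intro κ hκ
  ext t
  obtain ⟨k, hk⟩ := hT t
  have := hκ k
  rw [SModEq.sub_mem, sub_zero] at this
  refine Submodule.smul_induction_on this ?_ ?_
  · intro s hs κ' _
    exact val_zero hm κ' t k hk s hs
  · intro x y hx hy
    rw [LinearMap.add_apply, hx, hy]
    simp

lemma K_base [IsNoetherianRing A] (hm : (maximalIdeal R).map (algebraMap R A) = maximalIdeal A)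
    (ε : E) (hs : ∀ e : E, (∀ r ∈ maximalIdeal A, r • e = 0) → ∃ r : A, e = r • ε) (k : ℕ)
    [Module.Finite R T] (h : ∀ r ∈ maximalIdeal R ^ k, ∀ t : T, r • t = 0) : IsNoetherian A (T →ₗ[R] E) := by
  have := tors_noeth ε hs k
  obtain ⟨n, g, hg⟩ := Submodule.fg_iff_exists_fin_generating_family.1 (Module.Finite.fg_top (R := R) (M := T))
  let T' := Submodule.torsionBySet A E ((maximalIdeal A ^ k : Ideal A) : Set A)
  let F : (T →ₗ[R] E) →ₗ[A] (Fin n → T') :=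
    { toFun := fun κ i => ⟨κ (g i), by
        rw [Submodule.mem_torsionBySet_iff]
        intro s
        exact val_zero hm κ (g i) k (fun r hr => h r hr _) s s.2⟩
      map_add' := fun _ _ => rfl
      map_smul' := fun _ _ => rfl }
  refine isNoetherian_of_injective F ?_
  intro κ κ' hκ
  apply LinearMap.ext_on_range hg
  intro i
  exact congrArg Subtype.val (congrFun hκ i)

lemma K_base_ass [IsNoetherianRing A] (hm : (maximalIdeal R).map (algebraMap R A) = maximalIdeal A) (k : ℕ)
    (h : ∀ r ∈ maximalIdeal R ^ k, ∀ t : T, r • t = 0) (q : Ideal A) (hq : q ∈ associatedPrimes A (T →ₗ[R] E)) :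
    q = maximalIdeal A := by
  have hqp : q.IsPrime := hq.isPrime
  refine ((maximalIdeal.isMaximal A).eq_of_le hqp.ne_top ?_).symm
  rw [AssociatedPrimes.mem_iff, isAssociatedPrime_iff] at hq
  obtain ⟨-, κ, hκ⟩ := hq
  refine hqp.le_of_pow_le (n := k) ?_
  intro s hs
  rw [hκ, Submodule.mem_colon_singleton, Submodule.mem_bot]
  ext t
  exact val_zero hm κ t k (fun r hr => h r hr t) s hs

end setup

lemma dim_zero_pow {R : Type u} [CommRing R] [IsLocalRing R] [IsNoetherianRing R] {N : Type u} [AddCommGroup N]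
    [Module R N] [Module.Finite R N] (h : Module.supportDim R N < 1) : ∃ k, ∀ r ∈ maximalIdeal R ^ k,
    ∀ t : N, r • t = 0 := by
  have h1 : maximalIdeal R ≤ (Module.annihilator R N).radical := by
    rw [Ideal.radical_eq_sInf]
    refine le_sInf ?_
    rintro p ⟨hp, hpp⟩
    by_contra hc
    have hlt : p < maximalIdeal R := lt_of_le_of_ne (le_maximalIdeal hpp.ne_top) (fun h => hc h.ge)
    let P : PrimeSpectrum R := ⟨p, hpp⟩
    let Q : PrimeSpectrum R := ⟨maximalIdeal R, inferInstance⟩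
    have hP : P ∈ Module.support R N := Module.mem_support_iff_of_finite.2 hp
    have hQ : Q ∈ Module.support R N := Module.mem_support_iff_of_finite.2 (hp.trans hlt.le)
    let x : Module.support R N := ⟨P, hP⟩
    let y : Module.support R N := ⟨Q, hQ⟩
    have hxy : x < y := hlt
    have : (1 : WithBot ℕ∞) ≤ Module.supportDim R N := by
      exact Order.one_le_krullDim_iff.2 ⟨x, y, hxy⟩
    exact absurd h (not_lt.2 this)
  obtain ⟨k, hk⟩ := Ideal.exists_pow_le_of_le_radical_of_fg h1 (maximalIdeal R).fg_of_isNoetherianRing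
  exact ⟨k, fun r hr t => Module.mem_annihilator.1 (hk hr) t⟩

end LCproof


namespace LCproof
open scoped Pointwise
open IsLocalRing

lemma step_tors {R : Type u} [CommRing R] [IsLocalRing R] [IsNoetherianRing R]
    {T T0 : Type u} [AddCommGroup T] [Module R T] [AddCommGroup T0] [Module R T0]
    (a : Ideal R) (hTa : Tors a T) (x : R) (hx : x ∈ a) (δ : T0 →ₗ[R] T)
    (hδ : Function.Exact δ (fun z : T => x • z)) (h0 : Tors (maximalIdeal R) T0) : Tors (maximalIdeal R) T := by
  have key : ∀ t : ℕ, ∀ z : T, x ^ t • z = 0 → ∃ s, ∀ r ∈ maximalIdeal R ^ s, r • z = 0 := by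
    intro t
    induction t with
    | zero =>
      intro z hz
      exact ⟨0, fun r _ => by simp at hz; simp [hz]⟩
    | succ t ih =>
      intro z hz
      obtain ⟨s, hs⟩ := ih (x • z) (by rw [← mul_smul, ← pow_succ, hz])
      let W : Submodule R T := (maximalIdeal R ^ s) • Submodule.span R {z}
      have hW : W.FG := Submodule.FG.smul (Ideal.fg_of_isNoetherianRing _) (Submodule.fg_span_singleton z)
      have : Module.Finite R W := Module.Finite.iff_fg.2 hW
      have hWt : Tors (maximalIdeal R) W := by
        rintro ⟨w, hw⟩
        obtain ⟨r, hr, rfl⟩ := (Submodule.mem_smul_span_singleton).1 hw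
        have h2 : x • (r • z) = 0 := by rw [smul_comm]; exact hs r hr
        obtain ⟨y, hy⟩ := (hδ _).1 h2
        obtain ⟨l, hl⟩ := h0 y
        refine ⟨l, fun b hb => ?_⟩
        apply Subtype.ext
        change b • (r • z) = 0
        rw [← hy, ← map_smul, hl b hb, map_zero]
      obtain ⟨l, hl⟩ := fg_tors hWt
      refine ⟨l + s, fun r hr => ?_⟩
      rw [pow_add] at hr
      refine Submodule.mul_induction_on hr ?_ ?_
      · intro m hm n hn
        rw [mul_smul]
        exact congrArg Subtype.val (hl m hm ⟨n • z, Submodule.smul_mem_smul hn (Submodule.mem_span_singleton_self z)⟩)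
      · intro p q hp hq
        rw [add_smul, hp, hq, add_zero]
  intro z
  obtain ⟨t, ht⟩ := hTa z
  exact key t z (ht _ (Ideal.pow_mem_pow hx t))

section setup
variable {R A : Type u} [CommRing R] [CommRing A]
  [Algebra R A] {E : Type u} [AddCommGroup E] [Module A E] [Module R E] [IsScalarTower R A E]
  {T T0 : Type u} [AddCommGroup T] [Module R T] [AddCommGroup T0] [Module R T0]

/-- precomposition, as an `A`-linear map -/
def rho (A E : Type u) [CommRing A] [Algebra R A] [AddCommGroup E] [Module A E] [Module R E] [IsScalarTower R A E]
    (δ : T0 →ₗ[R] T) : (T →ₗ[R] E) →ₗ[A] (T0 →ₗ[R] E) where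
  toFun κ := κ ∘ₗ δ
  map_add' _ _ := rfl
  map_smul' _ _ := rfl

lemma rho_ker (δ : T0 →ₗ[R] T) (x : R) (hδ : Function.Exact δ (fun z : T => x • z))
    (hx : Function.Surjective (fun z : T => x • z)) (κ : T →ₗ[R] E) :
    rho A E δ κ = 0 ↔ ∃ κ' : T →ₗ[R] E, κ = algebraMap R A x • κ' := by
  constructor
  · intro h
    let L := LinearMap.lsmul R T x
    have hL : Function.Surjective L := hx
    have hle : LinearMap.ker L ≤ LinearMap.ker κ := by
      intro z hz
      obtain ⟨y, rfl⟩ := (hδ z).1 hz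
      exact LinearMap.congr_fun h y
    refine ⟨(LinearMap.ker L).liftQ κ hle ∘ₗ (L.quotKerEquivOfSurjective hL).symm.toLinearMap, ?_⟩
    ext z
    rw [algebraMap_smul, LinearMap.smul_apply, ← map_smul]
    change κ z = (LinearMap.ker L).liftQ κ hle ((L.quotKerEquivOfSurjective hL).symm (L z))
    have : (L.quotKerEquivOfSurjective hL).symm (L z) = Submodule.Quotient.mk z := by
      rw [LinearEquiv.symm_apply_eq]
      rfl
    rw [this]
    rfl
  · rintro ⟨κ', rfl⟩
    ext y
    change algebraMap R A x • κ' (δ y) = 0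
    rw [algebraMap_smul, ← map_smul]
    have : x • δ y = 0 := (hδ _).2 ⟨y, rfl⟩
    rw [this, map_zero]

lemma rho_reg (x : R) (hx : Function.Surjective (fun z : T => x • z)) (κ : T →ₗ[R] E)
    (h : algebraMap R A x • κ = 0) : κ = 0 := by
  ext z
  obtain ⟨y, rfl⟩ := hx z
  have := LinearMap.congr_fun h y
  rw [algebraMap_smul, LinearMap.smul_apply, ← map_smul] at this
  exact this

variable [IsLocalRing R] [IsLocalRing A] [IsNoetherianRing A]

lemma step_fin [IsPrecomplete (maximalIdeal A) A] (hm : (maximalIdeal R).map (algebraMap R A) = maximalIdeal A)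
    (δ : T0 →ₗ[R] T) (x : R) (hxm : x ∈ maximalIdeal R) (hδ : Function.Exact δ (fun z : T => x • z))
    (hx : Function.Surjective (fun z : T => x • z)) (hT : Tors (maximalIdeal R) T)
    [Module.Finite A (T0 →ₗ[R] E)] : Module.Finite A (T →ₗ[R] E) := by
  have := K_haus (E := E) hm hT
  have hfg : (LinearMap.range (rho A E δ)).FG := IsNoetherian.noetherian _
  obtain ⟨n, g, hg⟩ := Submodule.fg_iff_exists_fin_generating_family.1 hfg
  have hgr : ∀ i, ∃ k, rho A E δ k = g i := fun i => by
    have : g i ∈ LinearMap.range (rho A E δ) := by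
      rw [← hg]; exact Submodule.subset_span ⟨i, rfl⟩
    exact this
  choose k hk using hgr
  refine fin_of_haus (maximalIdeal A) n k fun z => ?_
  have hz : rho A E δ z ∈ Submodule.span A (Set.range g) := by
    rw [hg]; exact ⟨z, rfl⟩
  obtain ⟨c, hc⟩ := (Submodule.mem_span_range_iff_exists_fun A).1 hz
  refine ⟨c, ?_⟩
  obtain ⟨κ', hκ'⟩ := (rho_ker δ x hδ hx (z - ∑ i, c i • k i)).1 (by
    rw [map_sub, map_sum, ← hc, sub_eq_zero]
    refine Finset.sum_congr rfl fun i _ => ?_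
    rw [map_smul, hk])
  rw [hκ']
  refine Submodule.smul_mem_smul ?_ trivial
  rw [← hm]
  exact Ideal.mem_map_of_mem _ hxm

lemma step_ass (hm : (maximalIdeal R).map (algebraMap R A) = maximalIdeal A)
    (δ : T0 →ₗ[R] T) (x : R) (hxm : x ∈ maximalIdeal R) (hδ : Function.Exact δ (fun z : T => x • z))
    (hx : Function.Surjective (fun z : T => x • z))
    [Module.Finite A (T →ₗ[R] E)] (q : Ideal A) (hq : q ∈ associatedPrimes A (T →ₗ[R] E)) :
    algebraMap R A x ∉ q ∧ (∃ q' ∈ associatedPrimes A (T0 →ₗ[R] E), q ≤ q' ∧ algebraMap R A x ∈ q') := by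
  have hq' := hq
  rw [AssociatedPrimes.mem_iff, isAssociatedPrime_iff] at hq'
  obtain ⟨hqp, κ0, hκ0⟩ := hq'
  have mem_q : ∀ s, s ∈ q ↔ s • κ0 = 0 := fun s => by
    rw [hκ0, Submodule.mem_colon_singleton, Submodule.mem_bot]
  have hκ00 : κ0 ≠ 0 := by
    rintro rfl
    exact hqp.ne_top ((Ideal.eq_top_iff_one _).2 ((mem_q 1).2 (by simp)))
  refine ⟨fun h => hκ00 (rho_reg x hx κ0 ((mem_q _).1 h)), ?_⟩
  let G : Submodule A (T →ₗ[R] E) := Submodule.torsionBySet A _ (q : Set A)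
  have hG0 : κ0 ∈ G := by
    rw [Submodule.mem_torsionBySet_iff]
    intro s
    exact (mem_q _).1 s.2
  have hex : ∃ κ ∈ G, rho A E δ κ ≠ 0 := by
    by_contra hcon
    push Not at hcon
    have : G = ⊥ := by
      refine Submodule.eq_bot_of_le_smul_of_le_jacobson_bot (maximalIdeal A) G (IsNoetherian.noetherian _) ?_
        (by rw [IsLocalRing.jacobson_eq_maximalIdeal _ bot_ne_top])
      intro κ hκ
      obtain ⟨κ', rfl⟩ := (rho_ker δ x hδ hx κ).1 (hcon κ hκ)
      refine Submodule.smul_mem_smul (by rw [← hm]; exact Ideal.mem_map_of_mem _ hxm) ?_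
      rw [Submodule.mem_torsionBySet_iff] at hκ ⊢
      intro s
      apply rho_reg (A := A) x hx
      rw [smul_comm]
      exact hκ s
    rw [this] at hG0
    exact hκ00 (by simpa using hG0)
  obtain ⟨κ, hκ, hne⟩ := hex
  obtain ⟨q', hq', hle⟩ := exists_le_isAssociatedPrime_of_isNoetherianRing A _ hne
  refine ⟨q', hq', ?_, ?_⟩
  · intro s hs
    apply hle
    rw [Submodule.mem_colon_singleton, Submodule.mem_bot, ← map_smul]
    rw [Submodule.mem_torsionBySet_iff] at hκ
    rw [hκ ⟨s, hs⟩, map_zero]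
  · apply hle
    rw [Submodule.mem_colon_singleton, Submodule.mem_bot, ← map_smul]
    exact (rho_ker δ x hδ hx _).2 ⟨κ, rfl⟩

lemma step_supp 
    (δ : T0 →ₗ[R] T) (x : R) (hδ : Function.Exact δ (fun z : T => x • z))
    (hx : Function.Surjective (fun z : T => x • z))
    [Module.Finite A (T →ₗ[R] E)] (q : Ideal A) (hq : q ∈ associatedPrimes A (T →ₗ[R] E))
    (Q : Ideal A) [hQ : Q.IsPrime] (hqQ : q ≤ Q) (hxQ : algebraMap R A x ∈ Q) :
    ∃ q' ∈ associatedPrimes A (T0 →ₗ[R] E), q' ≤ Q := by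
  have hann : Module.annihilator A (T →ₗ[R] E) ≤ Q :=
    (le_of_eq_of_le Submodule.annihilator_top.symm (IsAssociatedPrime.annihilator_le hq)).trans hqQ
  have h1 : (⟨Q, hQ⟩ : PrimeSpectrum A) ∈ Module.support A (QuotSMulTop (algebraMap R A x) (T →ₗ[R] E)) := by
    rw [Module.support_quotSMulTop]
    exact ⟨Module.mem_support_iff_of_finite.2 hann, by simpa using hxQ⟩
  have hker : LinearMap.ker (rho A E δ) = algebraMap R A x • (⊤ : Submodule A (T →ₗ[R] E)) := by
    ext κ
    rw [LinearMap.mem_ker, rho_ker δ x hδ hx, Submodule.mem_smul_pointwise_iff_exists]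
    constructor
    · rintro ⟨κ', h⟩; exact ⟨κ', trivial, h.symm⟩
    · rintro ⟨κ', -, h⟩; exact ⟨κ', h.symm⟩
  let e : QuotSMulTop (algebraMap R A x) (T →ₗ[R] E) ≃ₗ[A] LinearMap.range (rho A E δ) :=
    (Submodule.quotEquivOfEq _ _ hker.symm).trans (rho A E δ).quotKerEquivRange
  have : Module.Finite A (LinearMap.range (rho A E δ)) := Module.Finite.equiv e
  rw [e.support_eq, Module.mem_support_iff_of_finite] at h1
  obtain ⟨q', hq', hle⟩ := Ideal.exists_minimalPrimes_le h1
  exact ⟨q', associatedPrimes.subset_of_injective (f := (LinearMap.range (rho A E δ)).subtype) Subtype.val_injective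
    (Module.associatedPrimes.minimalPrimes_annihilator_subset_associatedPrimes A _ hq'), hle⟩

end setup

lemma dim_succ {A : Type u} [CommRing A] {q q' : Ideal A} [hq : q.IsPrime] (h : q ≤ q') {x : A} (hx : x ∉ q) (hx' : x ∈ q')
    {n : ℕ} (hn : (n : WithBot ℕ∞) ≤ ringKrullDim (A ⧸ q')) : ((n + 1 : ℕ) : WithBot ℕ∞) ≤ ringKrullDim (A ⧸ q) := by
  have := ringKrullDim_succ_le_of_surjective (Ideal.Quotient.factor h) (Ideal.Quotient.factor_surjective h)
    (r := Ideal.Quotient.mk q x) (mem_nonZeroDivisors_of_ne_zero (by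
      rw [Ne, Ideal.Quotient.eq_zero_iff_mem]; exact hx)) (by
      rw [Ideal.Quotient.factor_mk, Ideal.Quotient.eq_zero_iff_mem]; exact hx')
  refine le_trans ?_ this
  push_cast
  gcongr

end LCproof


namespace LCproof
open scoped Pointwise
open IsLocalRing

section main
variable {R A : Type u} [CommRing R] [IsNoetherianRing R] [IsLocalRing R] [CommRing A] [IsNoetherianRing A]
  [IsLocalRing A] [Algebra R A] {E : Type u} [AddCommGroup E] [Module A E] [Module R E] [IsScalarTower R A E]

theorem main_ind [IsPrecomplete (maximalIdeal A) A] (hm : (maximalIdeal R).map (algebraMap R A) = maximalIdeal A)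
    (ε : E) (hs : ∀ e : E, (∀ r ∈ maximalIdeal A, r • e = 0) → ∃ r : A, e = r • ε)
    (a : Ideal R) (ha : a ≠ ⊤) (n : ℕ) : ∀ (N : Type u) [AddCommGroup N] [Module R N] [Module.Finite R N],
    Module.supportDim R N < (n + 1 : ℕ) →
    Tors (maximalIdeal R) (H a n N) ∧ Module.Finite A (H a n N →ₗ[R] E) ∧
      ∀ q ∈ associatedPrimes A (H a n N →ₗ[R] E), (n : WithBot ℕ∞) ≤ ringKrullDim (A ⧸ q) ∧
        ∀ Q : Ideal A, Q.IsPrime → q ≤ Q → a.map (algebraMap R A) ≤ Q → Q = maximalIdeal A := by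
  have ham := le_maximalIdeal ha
  induction n with
  | zero =>
    intro N _ _ _ hN
    obtain ⟨k, hk⟩ := dim_zero_pow (N := N) (by simpa using hN)
    have hk' : ∀ r ∈ maximalIdeal R ^ k, ∀ t : H a 0 N, r • t = 0 := by
      intro r hr t
      apply eps_inj a
      rw [map_smul, map_zero, hk r hr]
    have : Module.Finite R (H a 0 N) := Module.Finite.of_injective (eps a) (eps_inj a)
    have hN := K_base (E := E) hm ε hs k hk'
    refine ⟨fun z => ⟨k, fun r hr => hk' r hr z⟩, inferInstance, ?_⟩
    intro q hq
    have hqm := K_base_ass hm k hk' q hq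
    have hqp : q.IsPrime := hq.isPrime
    refine ⟨?_, fun Q hQ hqQ _ => ?_⟩
    · simpa using ringKrullDim_nonneg_of_nontrivial (R := A ⧸ q)
    · rw [hqm] at hqQ
      exact ((maximalIdeal.isMaximal A).eq_of_le hQ.ne_top hqQ).symm
  | succ n ih =>
    intro N _ _ _ hN
    obtain ⟨x, hxa, hx⟩ := exists_regular a (Gam_quot (N := N) a)
    have hd := dim_quot_lt hx (dim_red_lt a hN)
    obtain ⟨i1, i2, i3⟩ := ih (QuotSMulTop x (N ⧸ Gam a N)) hd
    obtain ⟨δ, h3, -, -⟩ := H_mulx a x hx n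
    obtain ⟨-, -, h4, -⟩ := H_mulx a x hx (n+1)
    have hvan := H_vanish a (n+1) (QuotSMulTop x (N ⧸ Gam a N)) hd (n+1) le_rfl
    let e : H a (n+1) N ≃ₗ[R] H a (n+1) (N ⧸ Gam a N) := LinearEquiv.ofBijective _ (H_red_bij a n)
    let δ' : H a n (QuotSMulTop x (N ⧸ Gam a N)) →ₗ[R] H a (n+1) N := e.symm.toLinearMap ∘ₗ δ
    have hδ' : Function.Exact δ' (fun z : H a (n+1) N => x • z) := by
      intro z
      have h5 := h3 (e z)
      beta_reduce at h5 ⊢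
      rw [← map_smul, LinearEquiv.map_eq_zero_iff] at h5
      rw [h5]
      constructor
      · rintro ⟨y, hy⟩
        exact ⟨y, by simp [δ', hy]⟩
      · rintro ⟨y, hy⟩
        exact ⟨y, by rw [← hy]; simp [δ']⟩
    have hsurj : Function.Surjective (fun z : H a (n+1) N => x • z) := by
      intro z
      obtain ⟨y, hy⟩ := (h4 (e z)).1 (Subsingleton.elim _ _)
      refine ⟨e.symm y, ?_⟩
      apply e.injective
      change e (x • _) = _
      rw [map_smul, LinearEquiv.apply_symm_apply]
      exact hy
    have hT := step_tors a (Tors_H a (n+1) N) x hxa δ' hδ' i1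
    have hfin := step_fin (E := E) hm δ' x (ham hxa) hδ' hsurj hT
    refine ⟨hT, hfin, ?_⟩
    intro q hq
    have hqp : q.IsPrime := hq.isPrime
    obtain ⟨hxq, q', hq', hle, hxq'⟩ := step_ass hm δ' x (ham hxa) hδ' hsurj q hq
    refine ⟨dim_succ hle hxq hxq' (i3 q' hq').1, ?_⟩
    intro Q hQ hqQ haQ
    obtain ⟨q2, hq2, hle2⟩ := step_supp δ' x hδ' hsurj q hq Q hqQ (haQ (Ideal.mem_map_of_mem _ hxa))
    exact (i3 q2 hq2).2 Q hQ hle2 haQ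

end main

end LCproof


namespace LCproof
open IsLocalRing

/-- cogenerator property -/
lemma cogen {R : Type u} [CommRing R] (c : Ideal R) [IsLocalRing (R ⧸ c)]
    {E : Type u} [AddCommGroup E] [Module (R ⧸ c) E] [Module R E] [IsScalarTower R (R ⧸ c) E]
    [Module.Injective (R ⧸ c) E] (ε : E) (hε : ε ≠ 0) (hk : ∀ s ∈ maximalIdeal (R ⧸ c), s • ε = 0)
    {W : Type u} [AddCommGroup W] [Module R W] (hW : ∀ r ∈ c, ∀ w : W, r • w = 0) (t : W) (ht : t ≠ 0) :
    ∃ f : W →ₗ[R] E, f t ≠ 0 := by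
  have hT : Module.IsTorsionBySet R W (c : Set R) := fun w r => hW r.1 r.2 w
  let _ : Module (R ⧸ c) W := hT.module
  have : IsScalarTower R (R ⧸ c) W := Module.IsTorsionBySet.isScalarTower hT
  obtain ⟨k, hk'⟩ := inj_ext (LinearMap.toSpanSingleton (R ⧸ c) W t) (LinearMap.toSpanSingleton (R ⧸ c) E ε) (by
    intro s hs
    rw [LinearMap.mem_ker, LinearMap.toSpanSingleton_apply] at hs ⊢
    apply hk
    rw [mem_maximalIdeal]
    intro hu
    exact ht ((hu.smul_eq_zero).1 hs))
  refine ⟨k.restrictScalars R, ?_⟩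
  have := hk' 1
  simp only [LinearMap.toSpanSingleton_apply, one_smul] at this
  simpa [this] using hε

lemma exists_ass {R A : Type u} [CommRing R] [CommRing A] [IsNoetherianRing A] [Algebra R A]
    {E : Type u} [AddCommGroup E] [Module A E] [Module R E] [IsScalarTower R A E]
    {T : Type u} [AddCommGroup T] [Module R T] (U : Submodule R T)
    (p : Ideal R) (hpp : p.IsPrime) (hp : p = Module.annihilator R (T ⧸ U))
    (hcog : ∀ t : T ⧸ U, t ≠ 0 → ∃ f : (T ⧸ U) →ₗ[R] E, f t ≠ 0)
    [Module.Finite A (T →ₗ[R] E)] :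
    ∃ q ∈ associatedPrimes A (T →ₗ[R] E), q.comap (algebraMap R A) = p := by
  have hinj : Function.Injective (rho A E U.mkQ) := by
    intro f g h
    ext x
    exact LinearMap.congr_fun h x
  have hfin : Module.Finite A ((T ⧸ U) →ₗ[R] E) := Module.Finite.of_injective _ hinj
  set J := Module.annihilator A ((T ⧸ U) →ₗ[R] E) with hJ
  have hcomap : J.comap (algebraMap R A) = p := by
    ext r
    rw [Ideal.mem_comap, hJ, Module.mem_annihilator, hp, Module.mem_annihilator]
    constructor
    · intro h w
      by_contra hw
      obtain ⟨f, hf⟩ := hcog _ hw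
      apply hf
      have := LinearMap.congr_fun (h f) w
      rw [map_smul]
      simpa using this
    · intro h f
      ext w
      have : algebraMap R A r • f (U.mkQ w) = 0 := by
        rw [algebraMap_smul, ← map_smul, h, map_zero]
      simpa using this
  have hfinm := Ideal.finite_minimalPrimes_of_isNoetherianRing A J
  have hle : ∃ q ∈ J.minimalPrimes, q.comap (algebraMap R A) ≤ p := by
    by_contra! hcon
    have hcon' : ∀ q ∈ hfinm.toFinset, ¬ q.comap (algebraMap R A) ≤ p := fun q hq => hcon q (hfinm.mem_toFinset.1 hq)
    have : ¬ (hfinm.toFinset.inf fun q => q.comap (algebraMap R A)) ≤ p := by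
      rw [hpp.inf_le']
      push Not
      exact hcon'
    apply this
    intro r hr
    rw [Submodule.mem_finsetInf] at hr
    have hrad : algebraMap R A r ∈ J.radical := by
      rw [← Ideal.sInf_minimalPrimes, Submodule.mem_sInf]
      intro q hq
      exact hr q (hfinm.mem_toFinset.2 hq)
    obtain ⟨k, hk⟩ := hrad
    rw [← map_pow] at hk
    have : r ^ k ∈ p := by rw [← hcomap]; exact hk
    exact hpp.mem_of_pow_mem k this
  obtain ⟨q, hq, hqp⟩ := hle
  refine ⟨q, associatedPrimes.subset_of_injective hinj
    (Module.associatedPrimes.minimalPrimes_annihilator_subset_associatedPrimes A _ hq), le_antisymm hqp ?_⟩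
  rw [← hcomap]
  exact Ideal.comap_mono hq.1.2

lemma dim_le {R B : Type u} [CommRing R] [IsNoetherianRing R] [IsLocalRing R] [CommRing B] [IsNoetherianRing B]
    [IsLocalRing B] (φ : R →+* B) (h : (maximalIdeal R).map φ = maximalIdeal B) :
    ringKrullDim B ≤ ringKrullDim R := by
  classical
  rw [← maximalIdeal_height_eq_ringKrullDim, ← maximalIdeal_height_eq_ringKrullDim]
  obtain ⟨s, hs, hc⟩ := Ideal.exists_finset_card_eq_height_of_isNoetherianRing (maximalIdeal R)
  rw [← hc]
  have : maximalIdeal B ∈ (Ideal.span ((s.image φ : Finset B) : Set B)).minimalPrimes := by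
    have hmap : Ideal.span ((s.image φ : Finset B) : Set B) = (Ideal.span (s : Set R)).map φ := by
      rw [Ideal.map_span, Finset.coe_image]
    rw [hmap]
    refine ⟨⟨inferInstance, ?_⟩, ?_⟩
    · rw [← h]; exact Ideal.map_mono hs.1.2
    · rintro Q ⟨hQ, hQ'⟩ -
      rw [← h, Ideal.map_le_iff_le_comap]
      rw [Ideal.map_le_iff_le_comap] at hQ'
      exact hs.2 ⟨Ideal.comap_isPrime φ Q, hQ'⟩ (le_maximalIdeal (Ideal.comap_isPrime φ Q).ne_top)
  have h2 := Ideal.height_le_card_of_mem_minimalPrimes_span_finset this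
  have h3 : (maximalIdeal B).height ≤ (s.card : ℕ∞) := h2.trans (by exact_mod_cast Finset.card_image_le)
  exact_mod_cast h3

end LCproof


namespace LCproof
open IsLocalRing

section
variable {R : Type u} [CommRing R] [IsNoetherianRing R] (a : Ideal R) (n : ℕ)

lemma H_right {N N' : Type u} [AddCommGroup N] [Module R N] [Module.Finite R N] [AddCommGroup N'] [Module R N']
    (hN : Module.supportDim R N < (n + 1 : ℕ)) (g : N →ₗ[R] N') (hg : Function.Surjective g) :
    Function.Surjective (Hm a n g) := by
  obtain ⟨δ, -, h2, -⟩ := H_les a (LinearMap.ker g).subtype g Subtype.val_injective hg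
    (LinearMap.exact_subtype_ker_map g) n
  have hk : Module.supportDim R (LinearMap.ker g) < (n + 1 : ℕ) :=
    lt_of_le_of_lt (Module.supportDim_le_of_injective (LinearMap.ker g).subtype Subtype.val_injective) hN
  have := H_vanish a (n+1) (LinearMap.ker g) hk (n+1) le_rfl
  intro z
  exact (h2 z).1 (Subsingleton.elim _ _)

lemma H_pi_sub {R : Type u} [CommRing R] (a : Ideal R) (n : ℕ) {ι : Type} [Fintype ι] {N : Type u} [AddCommGroup N] [Module R N] [Subsingleton (H a n N)] :
    Subsingleton (H a n (ι → N)) := by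
  classical
  have hid : (LinearMap.id : (ι → N) →ₗ[R] (ι → N)) =
      ∑ i, LinearMap.single R (fun _ => N) i ∘ₗ LinearMap.proj i := by
    ext i x j
    simp [Pi.single_apply, Finset.sum_apply]
  have hz : ∀ z : H a n (ι → N), z = 0 := by
    intro z
    have h1 := LinearMap.congr_fun (Hm_id (N := ι → N) a n) z
    rw [hid] at h1
    have hs : ∀ (s : Finset ι), Hm a n (∑ i ∈ s, LinearMap.single R (fun _ => N) i ∘ₗ LinearMap.proj i) z = 0 := by
      intro s
      induction s using Finset.induction_on with
      | empty => simp [Hm_zero]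
      | insert i s hi ih =>
        rw [Finset.sum_insert hi, Hm_add, LinearMap.add_apply, ih, Hm_comp, LinearMap.comp_apply,
          Subsingleton.elim (Hm a n _ z) 0, map_zero, add_zero]
    rw [hs] at h1
    exact h1.symm
  exact ⟨fun x y => (hz x).trans (hz y).symm⟩

lemma H_killed_sub (p : Ideal R) {W : Type u} [AddCommGroup W] [Module R W] [Module.Finite R W]
    (hp : Module.supportDim R (R ⧸ p) < (n + 1 : ℕ)) (hW : ∀ r ∈ p, ∀ w : W, r • w = 0)
    [Subsingleton (H a n (R ⧸ p))] : Subsingleton (H a n W) := by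
  have hT : Module.IsTorsionBySet R W (p : Set R) := fun w r => hW r.1 r.2 w
  let _ : Module (R ⧸ p) W := hT.module
  have : IsScalarTower R (R ⧸ p) W := Module.IsTorsionBySet.isScalarTower hT
  have : Module.Finite (R ⧸ p) W := Module.Finite.of_restrictScalars_finite R (R ⧸ p) W
  obtain ⟨k, f, hf⟩ := Module.Finite.exists_fin' (R ⧸ p) W
  have hd : Module.supportDim R (Fin k → R ⧸ p) < (n + 1 : ℕ) := by
    refine lt_of_le_of_lt ?_ hp
    rw [Module.supportDim_eq_ringKrullDim_quotient_annihilator, Module.supportDim_eq_ringKrullDim_quotient_annihilator]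
    have hle : Module.annihilator R (R ⧸ p) ≤ Module.annihilator R (Fin k → R ⧸ p) := by
      intro r hr
      rw [Module.mem_annihilator] at hr ⊢
      intro m
      ext i
      exact hr (m i)
    exact ringKrullDim_le_of_surjective (Ideal.Quotient.factor hle) (Ideal.Quotient.factor_surjective hle)
  have hs := H_right a n hd (f.restrictScalars R) hf
  have := H_pi_sub a n (ι := Fin k) (N := R ⧸ p)
  exact hs.subsingleton

lemma H_quot_nontrivial {M : Type u} [AddCommGroup M] [Module R M] [Module.Finite R M]
    (hM : Module.supportDim R M < (n + 1 : ℕ)) (p : Ideal R) (hp1 : p ≠ ⊤)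
    (hp : Module.supportDim R (R ⧸ p) < (n + 1 : ℕ)) (U : Submodule R (H a n M))
    (hU : p = Module.annihilator R (H a n M ⧸ U)) : Nontrivial (H a n (R ⧸ p)) := by
  by_contra hcon
  rw [not_nontrivial_iff_subsingleton] at hcon
  obtain ⟨k, x, hx⟩ := Submodule.fg_iff_exists_fin_generating_family.1 (IsNoetherian.noetherian p)
  let g : (Fin k → M) →ₗ[R] M := ∑ i, x i • LinearMap.proj i
  have hgk : ∀ i (m : M), x i • m ∈ LinearMap.range g := by
    intro i m
    refine ⟨Pi.single i m, ?_⟩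
    simp [g, LinearMap.sum_apply, Pi.single_apply]
  have hW : ∀ r ∈ p, ∀ w : M ⧸ LinearMap.range g, r • w = 0 := by
    intro r hr w
    obtain ⟨m, rfl⟩ := Submodule.mkQ_surjective _ w
    rw [← map_smul, Submodule.mkQ_apply, Submodule.Quotient.mk_eq_zero]
    rw [← hx] at hr
    refine Submodule.span_induction ?_ ?_ ?_ ?_ hr
    · rintro _ ⟨i, rfl⟩
      exact hgk i m
    · simp
    · intro y z _ _ hy hz
      rw [add_smul]
      exact add_mem hy hz
    · intro s y _ hy
      rw [smul_eq_mul, mul_smul]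
      exact Submodule.smul_mem _ _ hy
  have hsub := H_killed_sub a n p hp hW
  obtain ⟨-, h1, -, -⟩ := H_les a (LinearMap.range g).subtype (LinearMap.range g).mkQ Subtype.val_injective
    (Submodule.mkQ_surjective _) (LinearMap.exact_subtype_mkQ _) n
  have hd : Module.supportDim R (Fin k → M) < (n + 1 : ℕ) := by
    refine lt_of_le_of_lt ?_ hM
    rw [Module.supportDim_eq_ringKrullDim_quotient_annihilator, Module.supportDim_eq_ringKrullDim_quotient_annihilator]
    have hle : Module.annihilator R M ≤ Module.annihilator R (Fin k → M) := by
      intro r hr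
      rw [Module.mem_annihilator] at hr ⊢
      intro m
      ext i
      exact hr (m i)
    exact ringKrullDim_le_of_surjective (Ideal.Quotient.factor hle) (Ideal.Quotient.factor_surjective hle)
  have hs := H_right a n hd g.rangeRestrict g.surjective_rangeRestrict
  have hz : ∀ z : H a n M, U.mkQ z = 0 := by
    intro z
    obtain ⟨y, rfl⟩ := (h1 z).1 (Subsingleton.elim _ _)
    obtain ⟨w, rfl⟩ := hs y
    rw [← LinearMap.comp_apply (Hm a n _), ← Hm_comp]
    have hg : (LinearMap.range g).subtype ∘ₗ g.rangeRestrict = ∑ i, x i • LinearMap.proj i := by ext; rfl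
    rw [hg]
    have key : ∀ s : Finset (Fin k), U.mkQ (Hm a n (∑ i ∈ s, x i • (LinearMap.proj i : (Fin k → M) →ₗ[R] M)) w) = 0 := by
      intro s
      induction s using Finset.induction_on with
      | empty => simp [Hm_zero]
      | insert i s hi ih =>
        rw [Finset.sum_insert hi, Hm_add, LinearMap.add_apply, map_add, ih, Hm_smul, LinearMap.smul_apply, map_smul,
          add_zero]
        have hxi : x i ∈ p := by rw [← hx]; exact Submodule.subset_span ⟨i, rfl⟩
        rw [hU, Module.mem_annihilator] at hxi
        exact hxi _
    exact key _
  apply hp1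
  rw [hU, Ideal.eq_top_iff_one, Module.mem_annihilator]
  intro w
  obtain ⟨z, rfl⟩ := Submodule.mkQ_surjective _ w
  rw [hz, smul_zero]

end
end LCproof


namespace LCproof
open IsLocalRing

lemma H_ann {R : Type u} [CommRing R] (a : Ideal R) (n : ℕ) {M : Type u} [AddCommGroup M] [Module R M] (r : R)
    (hr : r ∈ Module.annihilator R M) (z : H a n M) : r • z = 0 := by
  rw [← Hm_lsmul]
  have : LinearMap.lsmul R M r = 0 := by
    ext m
    exact Module.mem_annihilator.1 hr m
  rw [this, Hm_zero, LinearMap.zero_apply]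

theorem final_alg {R A : Type u} [CommRing R] [IsNoetherianRing R] [IsLocalRing R] (c : Ideal R)
    [IsLocalRing (R ⧸ c)] [CommRing A] [IsNoetherianRing A]
    [IsLocalRing A] [Algebra R A] [Algebra (R ⧸ c) A] [IsScalarTower R (R ⧸ c) A] [Module.Flat (R ⧸ c) A]
    [IsPrecomplete (maximalIdeal A) A] (hm : (maximalIdeal R).map (algebraMap R A) = maximalIdeal A)
    (a : Ideal R) (ha : a ≠ ⊤) (n : ℕ) {M : Type u} [AddCommGroup M] [Module R M] [Module.Finite R M]
    (hc : c = Module.annihilator R M) (hM : Module.supportDim R M = n) (p : Ideal R) (hpp : p.IsPrime)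
    (U : Submodule R (H a n M)) (hU : p = Module.annihilator R (H a n M ⧸ U)) :
    ringKrullDim (R ⧸ p) = n ∧ ∃ q ∈ associatedPrimes A A, ringKrullDim (A ⧸ q) = ringKrullDim A ∧
      p = q.comap (algebraMap R A) ∧ ringKrullDim (A ⧸ (a.map (algebraMap R A) ⊔ q)) = 0 := by
  obtain ⟨E, _, _, _, ε, hε, hε0, hs⟩ := exists_hull A
  let _ : Module (R ⧸ c) E := Module.compHom E (algebraMap (R ⧸ c) A)
  let _ : Module R E := Module.compHom E (algebraMap R A)
  have t1 : IsScalarTower R A E := IsScalarTower.of_algebraMap_smul fun _ _ => rfl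
  have t2 : IsScalarTower (R ⧸ c) A E := IsScalarTower.of_algebraMap_smul fun _ _ => rfl
  have t3 : IsScalarTower R (R ⧸ c) E := IsScalarTower.of_algebraMap_smul fun r e => by
    change algebraMap (R ⧸ c) A (algebraMap R (R ⧸ c) r) • e = algebraMap R A r • e
    rw [← IsScalarTower.algebraMap_apply]
  have hSE : Module.Injective (R ⧸ c) E := inj_flat (A := A) E
  have hmS : ∀ s ∈ maximalIdeal (R ⧸ c), algebraMap (R ⧸ c) A s ∈ maximalIdeal A := by
    intro s hs'
    obtain ⟨r, rfl⟩ := Ideal.Quotient.mk_surjective s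
    have hr : r ∈ maximalIdeal R := by
      rw [mem_maximalIdeal] at hs' ⊢
      exact fun hu => hs' (hu.map _)
    have h1 : algebraMap (R ⧸ c) A (Ideal.Quotient.mk c r) = algebraMap R A r :=
      (IsScalarTower.algebraMap_apply R (R ⧸ c) A r).symm
    rw [h1, ← hm]
    exact Ideal.mem_map_of_mem _ hr
  have hT : ∀ r ∈ c, ∀ w : H a n M ⧸ U, r • w = 0 := by
    intro r hr w
    obtain ⟨z, rfl⟩ := Submodule.mkQ_surjective _ w
    rw [← map_smul, H_ann a n r (hc ▸ hr), map_zero]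
  have hcp : c ≤ p := fun r hr => by
    rw [hU, Module.mem_annihilator]
    exact hT r hr
  obtain ⟨-, hfin, hass⟩ := main_ind (A := A) hm ε hs a ha n M (by rw [hM]; exact_mod_cast Nat.lt_succ_self n)
  obtain ⟨q, hq, hqp⟩ := exists_ass (A := A) U p hpp hU
    (fun t ht => cogen c ε hε (fun s hs' => by rw [← algebraMap_smul A s ε]; exact hε0 _ (hmS s hs')) hT t ht)
  obtain ⟨hqn, hqQ⟩ := hass q hq
  have hqprime : q.IsPrime := hq.isPrime
  have hdA : ringKrullDim A ≤ n := by
    rw [← hM, Module.supportDim_eq_ringKrullDim_quotient_annihilator, ← hc]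
    refine dim_le (algebraMap (R ⧸ c) A) (le_antisymm (Ideal.map_le_iff_le_comap.2 hmS) ?_)
    rw [← hm, IsScalarTower.algebraMap_eq R (R ⧸ c) A, ← Ideal.map_map,
      map_maximalIdeal_of_surjective (algebraMap R (R ⧸ c)) Ideal.Quotient.mk_surjective]
  have hdq : ringKrullDim (A ⧸ q) ≤ ringKrullDim A := ringKrullDim_quotient_le q
  have hAn : ringKrullDim A = n := le_antisymm hdA (hqn.trans hdq)
  have hqA : ringKrullDim (A ⧸ q) = n := le_antisymm (hdq.trans hdA) hqn
  refine ⟨le_antisymm ?_ ?_, q, ?_, hqA.trans hAn.symm, hqp.symm, ?_⟩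
  · rw [← hM, Module.supportDim_eq_ringKrullDim_quotient_annihilator, ← hc]
    exact ringKrullDim_le_of_surjective (Ideal.Quotient.factor hcp) (Ideal.Quotient.factor_surjective hcp)
  · rw [← hqA]
    have : IsLocalRing (R ⧸ p) := IsLocalRing.of_surjective' (Ideal.Quotient.mk p) Ideal.Quotient.mk_surjective
    have : IsLocalRing (A ⧸ q) := IsLocalRing.of_surjective' (Ideal.Quotient.mk q) Ideal.Quotient.mk_surjective
    refine dim_le (Ideal.quotientMap q (algebraMap R A) hqp.ge) ?_
    rw [← map_maximalIdeal_of_surjective (Ideal.Quotient.mk p) Ideal.Quotient.mk_surjective,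
      ← map_maximalIdeal_of_surjective (Ideal.Quotient.mk q) Ideal.Quotient.mk_surjective, ← hm, Ideal.map_map,
      Ideal.map_map, Ideal.quotientMap_comp_mk]
  · have hmin : q ∈ (Module.annihilator A A).minimalPrimes := by
      refine ⟨⟨hqprime, ?_⟩, ?_⟩
      · intro r hr
        have h1 := Module.mem_annihilator.1 hr 1
        rw [smul_eq_mul, mul_one] at h1
        rw [h1]
        exact zero_mem _
      · rintro q' ⟨hq', -⟩ hle x hx
        by_contra hx'
        have h1 := dim_succ hle hx' hx hqn
        have h2 := h1.trans ((ringKrullDim_quotient_le q').trans hdA)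
        have h3 : n + 1 ≤ n := by exact_mod_cast h2
        omega
    exact Module.associatedPrimes.minimalPrimes_annihilator_subset_associatedPrimes A _ hmin
  · have hle : a.map (algebraMap R A) ⊔ q ≤ maximalIdeal A := by
      refine sup_le ?_ (le_maximalIdeal hqprime.ne_top)
      rw [← hm]
      exact Ideal.map_mono (le_maximalIdeal ha)
    have hnt : Nontrivial (A ⧸ (a.map (algebraMap R A) ⊔ q)) :=
      Ideal.Quotient.nontrivial_iff.2 fun h => (maximalIdeal.isMaximal A).ne_top (top_le_iff.1 (h ▸ hle))
    refine le_antisymm ?_ ringKrullDim_nonneg_of_nontrivial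
    have : Ring.KrullDimLE 0 (A ⧸ (a.map (algebraMap R A) ⊔ q)) := by
      rw [Ring.krullDimLE_zero_iff]
      intro P hP
      have hP1 : (P.comap (Ideal.Quotient.mk _)).IsPrime := Ideal.comap_isPrime _ P
      have hle2 : a.map (algebraMap R A) ⊔ q ≤ P.comap (Ideal.Quotient.mk _) := by
        intro x hx
        rw [Ideal.mem_comap, Ideal.Quotient.eq_zero_iff_mem.2 hx]
        exact zero_mem _
      have hP2 := hqQ _ hP1 (le_sup_right.trans hle2) (le_sup_left.trans hle2)
      have hP3 : (P.comap (Ideal.Quotient.mk (a.map (algebraMap R A) ⊔ q))).IsMaximal := hP2 ▸ maximalIdeal.isMaximal A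
      have := Ideal.map_comap_of_surjective _ Ideal.Quotient.mk_surjective P
      rw [← this]
      exact (Ideal.map_eq_top_or_isMaximal_of_surjective _ Ideal.Quotient.mk_surjective hP3).resolve_left
        (by rw [this]; exact hP.ne_top)
    exact (Order.krullDimLE_iff 0 _).1 this

end LCproof


namespace LCproof
open IsLocalRing

theorem final_alg' {R A : Type u} [CommRing R] [IsNoetherianRing R] [IsLocalRing R] (c : Ideal R)
    [IsLocalRing (R ⧸ c)] [CommRing A] [IsNoetherianRing A]
    [IsLocalRing A] [Algebra (R ⧸ c) A] [Module.Flat (R ⧸ c) A]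
    [IsPrecomplete (maximalIdeal A) A] (hm : (maximalIdeal (R ⧸ c)).map (algebraMap (R ⧸ c) A) = maximalIdeal A)
    (φ : R →+* A) (hφ : φ = (algebraMap (R ⧸ c) A).comp (Ideal.Quotient.mk _))
    (a : Ideal R) (ha : a ≠ ⊤) (n : ℕ) {M : Type u} [AddCommGroup M] [Module R M] [Module.Finite R M]
    (hc : c = Module.annihilator R M) (hM : Module.supportDim R M = n) (p : Ideal R) (hpp : p.IsPrime)
    (U : Submodule R (H a n M)) (hU : p = Module.annihilator R (H a n M ⧸ U)) :
    ringKrullDim (R ⧸ p) = n ∧ ∃ q ∈ associatedPrimes A A, ringKrullDim (A ⧸ q) = ringKrullDim A ∧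
      p = q.comap φ ∧ ringKrullDim (A ⧸ (a.map φ ⊔ q)) = 0 := by
  let alg : Algebra R A := φ.toAlgebra
  have hφ' : algebraMap R A = φ := rfl
  have : IsScalarTower R (R ⧸ c) A := IsScalarTower.of_algebraMap_eq' (hφ'.trans hφ)
  refine final_alg (A := A) c ?_ a ha n hc hM p hpp U hU
  rw [IsScalarTower.algebraMap_eq R (R ⧸ c), ← Ideal.map_map,
      map_maximalIdeal_of_surjective (algebraMap R (R ⧸ c)) Ideal.Quotient.mk_surjective, hm]

theorem final_compl {R : Type u} [CommRing R] [IsNoetherianRing R] [IsLocalRing R] (c : Ideal R)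
    [IsLocalRing (R ⧸ c)] (I : Ideal (R ⧸ c)) (hI : I = maximalIdeal (R ⧸ c))
    (a : Ideal R) (ha : a ≠ ⊤) (n : ℕ) {M : Type u} [AddCommGroup M] [Module R M] [Module.Finite R M]
    (hc : c = Module.annihilator R M) (hM : Module.supportDim R M = n) (p : Ideal R) (hpp : p.IsPrime)
    (U : Submodule R (H a n M)) (hU : p = Module.annihilator R (H a n M ⧸ U)) (φ : R →+* AdicCompletion I (R ⧸ c))
    (hφ : φ = (algebraMap (R ⧸ c) (AdicCompletion I (R ⧸ c))).comp (Ideal.Quotient.mk _)) :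
    ringKrullDim (R ⧸ p) = n ∧ ∃ q ∈ associatedPrimes (AdicCompletion I (R ⧸ c)) (AdicCompletion I (R ⧸ c)),
      ringKrullDim (AdicCompletion I (R ⧸ c) ⧸ q) = ringKrullDim (AdicCompletion I (R ⧸ c)) ∧
      p = q.comap φ ∧ ringKrullDim (AdicCompletion I (R ⧸ c) ⧸ (a.map φ ⊔ q)) = 0 := by
  subst hI
  have := compl_noeth (R ⧸ c) (maximalIdeal (R ⧸ c))
  have : Module.Flat (R ⧸ c) (AdicCompletion (maximalIdeal (R ⧸ c)) (R ⧸ c)) := AdicCompletion.flat_of_isNoetherian _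
  have hpre : IsPrecomplete (maximalIdeal (AdicCompletion (maximalIdeal (R ⧸ c)) (R ⧸ c)))
    (AdicCompletion (maximalIdeal (R ⧸ c)) (R ⧸ c)) := inferInstance
  exact final_alg' (A := AdicCompletion (maximalIdeal (R ⧸ c)) (R ⧸ c)) c AdicCompletion.maximalIdeal_eq_map.symm φ hφ
    a ha n hc hM p hpp U hU

end LCproof

theorem stmt18 (R : Type u) [CommRing R] [IsNoetherianRing R] [IsLocalRing R]
    (a : Ideal R) (ha : a ≠ ⊤)
    (M : Type u) [AddCommGroup M] [Module R M] [Module.Finite R M]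
    (n : ℕ) (hdim : mdim R M = (n : ℕ∞))
    (p : Ideal R) (hp : p ∈ Att R (LC a n M)) :
    cohDim R a (R ⧸ p) = (n : ℕ∞) ∧ mdim R (R ⧸ p) = (n : ℕ∞) ∧
    (let S := R ⧸ Module.annihilator R M
     let mS : Ideal S := (IsLocalRing.maximalIdeal R).map (Ideal.Quotient.mk _)
     let Shat := AdicCompletion mS S
     let φ : R →+* Shat := (algebraMap S Shat).comp (Ideal.Quotient.mk _)
     ∃ q : Ideal Shat,
       q ∈ associatedPrimes Shat Shat ∧
       mdim Shat (Shat ⧸ q) = mdim Shat Shat ∧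
       p = q.comap φ ∧
       mdim Shat (Shat ⧸ (a.map φ ⊔ q)) = (0 : ℕ∞)) := by
  obtain ⟨hpp, U0, hU0⟩ := hp
  let e := LCproof.LCequiv a n M
  let U : Submodule R (LCproof.H a n M) := U0.map e.toLinearMap
  have hU : p = Module.annihilator R (LCproof.H a n M ⧸ U) :=
    hU0.trans (LinearEquiv.annihilator_eq (Submodule.Quotient.equiv U0 U e rfl))
  have hM : Module.supportDim R M = (n : WithBot ℕ∞) := hdim
  have hM1 : Module.supportDim R M < (n + 1 : ℕ) := by
    rw [hM]; exact_mod_cast Nat.lt_succ_self n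
  have hnM : Nontrivial M := by
    rw [← Module.supportDim_ne_bot_iff_nontrivial R, hM]
    exact WithBot.coe_ne_bot
  have hcne : Module.annihilator R M ≠ ⊤ := by
    rw [Ne, Module.annihilator_eq_top_iff, not_subsingleton_iff_nontrivial]
    exact hnM
  have hnt : Nontrivial (R ⧸ Module.annihilator R M) := Ideal.Quotient.nontrivial_iff.2 hcne
  have hloc : IsLocalRing (R ⧸ Module.annihilator R M) :=
    IsLocalRing.of_surjective' (Ideal.Quotient.mk _) Ideal.Quotient.mk_surjective
  obtain ⟨hdp, q, hq, h1, h2, h3⟩ := LCproof.final_compl (Module.annihilator R M)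
    ((IsLocalRing.maximalIdeal R).map (Ideal.Quotient.mk _))
    (IsLocalRing.map_maximalIdeal_of_surjective _ Ideal.Quotient.mk_surjective) a ha n rfl hM p hpp U hU _ rfl
  have hdp' : Module.supportDim R (R ⧸ p) = (n : WithBot ℕ∞) := by
    rw [Module.supportDim_quotient_eq_ringKrullDim, hdp]
  have hdp1 : Module.supportDim R (R ⧸ p) < (n + 1 : ℕ) := by
    rw [hdp']; exact_mod_cast Nat.lt_succ_self n
  refine ⟨?_, hdp', q, hq, ?_, h2, ?_⟩
  · apply le_antisymm
    · apply sSup_le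
      rintro _ ⟨i, rfl, hi⟩
      by_contra hcon
      have hin : n + 1 ≤ i := by
        by_contra hlt
        apply hcon
        have : i ≤ n := by omega
        exact_mod_cast this
      have := LCproof.H_vanish a (n+1) (R ⧸ p) hdp1 i hin
      exact not_subsingleton_iff_nontrivial.2 hi (LCproof.LCequiv a i (R ⧸ p)).injective.subsingleton
    · apply le_sSup
      refine ⟨n, rfl, ?_⟩
      have := LCproof.H_quot_nontrivial a n hM1 p hpp.ne_top hdp1 U hU
      exact (LCproof.LCequiv a n (R ⧸ p)).surjective.nontrivial
  · refine (Module.supportDim_quotient_eq_ringKrullDim q).trans (h1.trans ?_)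
    exact (Module.supportDim_self_eq_ringKrullDim _).symm
  · exact (Module.supportDim_quotient_eq_ringKrullDim _).trans h3

end
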